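/- arXiv:1611.05498 — 3 statements merged into one kernel-verified Lean document; each statement's English description precedes it below -/
import Mathlib

section
/- Let σ be a simple arc in 𝔸 and let η be an arc with the same two endpoints as σ which is disjoint from σ except at those endpoints. Then |W(σ)| ≤ D(η) + 1. -/
/- STATEMENT 11: If `σ` is a simple arc in the annulus and `η` is an arc with
the same two endpoints, disjoint from `σ` except at those endpoints, then
`|W(σ)| ≤ D(η) + 1`.  Winding and homotopical diameter are computed through
arbitrary continuous lifts (they do not depend on the choices). -/

noncomputable section
open Set Metric Filter Topology Function

/-- The circle `ℝ/ℤ`. -/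
abbrev 𝕊 : Type := AddCircle (1:ℝ)
/-- The open annulus `𝔸 = ℝ²/⟨T₁⟩`. -/
abbrev 𝔸 : Type := 𝕊 × ℝ

/-- The covering projection `τ : ℝ² → 𝔸`. -/
def τ : ℝ × ℝ → 𝔸 := fun p => ((p.1 : 𝕊), p.2)

/-- `σt` is a continuous lift of the arc `σ : [a,b] → 𝔸` through `τ`. -/
def IsLiftOn (σt : ℝ → ℝ × ℝ) (σ : ℝ → 𝔸) (a b : ℝ) : Prop :=
  ContinuousOn σt (Set.Icc a b) ∧ ∀ s ∈ Set.Icc a b, τ (σt s) = σ s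

/-- The winding `W` of an arc computed from a lift `σt : [a,b] → ℝ²`. -/
def W (σt : ℝ → ℝ × ℝ) (a b : ℝ) : ℝ := (σt b).1 - (σt a).1

/-- The homotopical diameter `D` of an arc computed from a lift `σt : [a,b] → ℝ²`. -/
def D (σt : ℝ → ℝ × ℝ) (a b : ℝ) : ℝ :=
  Metric.diam (Prod.fst '' (σt '' Set.Icc a b))

section Auxiliary

open scoped Real ComplexConjugate

/-- `φ` is an argument of the nonzero complex number `z`. -/
def IsArg (z : ℂ) (φ : ℝ) : Prop :=
  z ≠ 0 ∧ z = ‖z‖ * Complex.exp (φ * Complex.I)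

namespace IsArg

variable {z : ℂ} {φ ψ : ℝ}

theorem re_eq (h : IsArg z φ) : z.re = ‖z‖ * Real.cos φ := by
  conv_lhs => rw [h.2]
  rw [Complex.re_ofReal_mul, Complex.exp_ofReal_mul_I_re]

theorem im_eq (h : IsArg z φ) : z.im = ‖z‖ * Real.sin φ := by
  conv_lhs => rw [h.2]
  rw [Complex.im_ofReal_mul, Complex.exp_ofReal_mul_I_im]

theorem sin_nonneg (h : IsArg z φ) (hz : 0 ≤ z.im) : 0 ≤ Real.sin φ :=
  nonneg_of_mul_nonneg_right (h.im_eq ▸ hz) (norm_pos_iff.2 h.1)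

theorem sin_nonpos (h : IsArg z φ) (hz : z.im ≤ 0) : Real.sin φ ≤ 0 := by
  have h0 := norm_pos_iff.2 h.1
  have := h.im_eq
  by_contra! hc
  nlinarith [mul_pos h0 hc]

theorem cos_nonneg (h : IsArg z φ) (hz : 0 ≤ z.re) : 0 ≤ Real.cos φ :=
  nonneg_of_mul_nonneg_right (h.re_eq ▸ hz) (norm_pos_iff.2 h.1)

theorem cos_nonpos (h : IsArg z φ) (hz : z.re ≤ 0) : Real.cos φ ≤ 0 := by
  have h0 := norm_pos_iff.2 h.1
  have := h.re_eq
  by_contra! hc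
  nlinarith [mul_pos h0 hc]

theorem neg (h : IsArg z φ) : IsArg (-z) (φ - π) := by
  refine ⟨neg_ne_zero.2 h.1, ?_⟩
  rw [norm_neg, Complex.ofReal_sub, sub_mul, Complex.exp_sub, Complex.exp_pi_mul_I, div_neg,
    div_one, mul_neg, ← h.2]

theorem exists_sub_eq (h : IsArg z φ) (h' : IsArg z ψ) : ∃ n : ℤ, φ - ψ = n * (2 * π) := by
  have h1 : Complex.exp (φ * Complex.I) = Complex.exp (ψ * Complex.I) :=
    mul_left_cancel₀ (Complex.ofReal_ne_zero.2 (norm_ne_zero_iff.2 h.1)) (h.2.symm.trans h'.2)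
  obtain ⟨n, hn⟩ := Complex.exp_eq_exp_iff_exists_int.1 h1
  refine ⟨n, ?_⟩
  have h2 : ((φ - ψ : ℝ) : ℂ) * Complex.I = ((n * (2 * π) : ℝ) : ℂ) * Complex.I := by
    push_cast
    rw [sub_mul, hn]
    ring
  exact Complex.ofReal_injective (mul_right_cancel₀ Complex.I_ne_zero h2)

theorem eq_of_abs_sub_lt (h : IsArg z φ) (h' : IsArg z ψ) (hlt : |φ - ψ| < 2 * π) : φ = ψ := by
  obtain ⟨n, hn⟩ := h.exists_sub_eq h'
  rw [hn, abs_mul, abs_of_pos Real.two_pi_pos, mul_lt_iff_lt_one_left Real.two_pi_pos] at hlt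
  have : n = 0 := Int.abs_lt_one_iff.1 (by exact_mod_cast hlt)
  subst this
  simp only [Int.cast_zero, zero_mul] at hn
  linarith

theorem of_arg (hz : z ≠ 0) : IsArg z z.arg :=
  ⟨hz, (Complex.norm_mul_exp_arg_mul_I z).symm⟩

end IsArg

theorem isArg_neg_of_pos {r : ℝ} (hr : 0 < r) : IsArg (-(r : ℂ)) π := by
  refine ⟨neg_ne_zero.2 (Complex.ofReal_ne_zero.2 hr.ne'), ?_⟩
  rw [norm_neg, Complex.norm_real, Real.norm_of_nonneg hr.le, Complex.exp_pi_mul_I]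
  ring

/-- A nowhere vanishing continuous function on the plane has a continuous argument, with a
prescribed value at a given point. -/
theorem exists_continuous_isArg {f : ℝ × ℝ → ℂ} (hf : Continuous f) (h0 : ∀ p, f p ≠ 0)
    {p₀ : ℝ × ℝ} {φ : ℝ} (hφ : IsArg (f p₀) φ) :
    ∃ θ : ℝ × ℝ → ℝ, Continuous θ ∧ θ p₀ = φ ∧ ∀ p, IsArg (f p) (θ p) := by
  have he : Complex.exp (Real.log ‖f p₀‖ + φ * Complex.I) = (⟨f, hf⟩ : C(ℝ × ℝ, ℂ)) p₀ := by
    rw [Complex.exp_add, ← Complex.ofReal_exp, Real.exp_log (norm_pos_iff.2 (h0 p₀))]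
    exact hφ.2.symm
  obtain ⟨F, ⟨hF0, hF⟩, -⟩ :=
    Complex.isCoveringMapOn_exp.existsUnique_continuousMap_lifts ⟨f, hf⟩ he (fun p => h0 p)
  refine ⟨fun p => (F p).im, Complex.continuous_im.comp F.continuous, by simp [hF0],
    fun p => ⟨h0 p, ?_⟩⟩
  have hp : Complex.exp (F p) = f p := congrFun hF p
  rw [← hp, Complex.norm_exp, Complex.ofReal_exp, ← Complex.exp_add, Complex.re_add_im]

/-- A continuous function with values in the union of the intervals `[c + 2πn, c + 2πn + π]`
stays in one of them. -/
theorem mem_Icc_of_sin_sub_nonneg {θ : ℝ → ℝ} (hθ : Continuous θ) {c : ℝ}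
    (hs : ∀ u, 0 ≤ Real.sin (θ u - c)) {u₀ : ℝ} (h₀ : θ u₀ ∈ Set.Icc c (c + π)) (u : ℝ) :
    θ u ∈ Set.Icc c (c + π) := by
  have hπ := Real.pi_pos
  have hconn : IsPreconnected (Set.range θ) := isPreconnected_range hθ
  constructor
  · by_contra! hlt
    obtain ⟨v, hv⟩ : max (θ u) (c - π / 2) ∈ Set.range θ :=
      hconn.Icc_subset ⟨u, rfl⟩ ⟨u₀, rfl⟩
        ⟨le_max_left _ _, max_le (by linarith [h₀.1]) (by linarith [h₀.1])⟩
    refine (hs v).not_gt (Real.sin_neg_of_neg_of_neg_pi_lt ?_ ?_)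
    · rw [hv, sub_neg]
      exact max_lt hlt (by linarith)
    · have := le_max_right (θ u) (c - π / 2)
      linarith
  · by_contra! hlt
    obtain ⟨v, hv⟩ : min (θ u) (c + 3 * π / 2) ∈ Set.range θ :=
      hconn.Icc_subset ⟨u₀, rfl⟩ ⟨u, rfl⟩
        ⟨le_min (by linarith [h₀.2]) (by linarith [h₀.2]), min_le_left _ _⟩
    have h1 : c + π < θ v := hv ▸ lt_min hlt (by linarith)
    have h2 : θ v ≤ c + 3 * π / 2 := hv ▸ min_le_right _ _
    have h3 := hs v
    rw [← Real.sin_sub_two_pi] at h3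
    exact h3.not_gt (Real.sin_neg_of_neg_of_neg_pi_lt (by linarith) (by linarith))

/-- Two continuous arguments of the same function which agree at a point are equal. -/
theorem eq_of_isArg_of_isArg {f : ℝ → ℂ} {α β : ℝ → ℝ} (hα : Continuous α) (hβ : Continuous β)
    (hfα : ∀ u, IsArg (f u) (α u)) (hfβ : ∀ u, IsArg (f u) (β u)) {u₀ : ℝ} (h₀ : α u₀ = β u₀)
    (u : ℝ) : α u = β u := by
  have hπ := Real.pi_pos
  have hs : ∀ u, Real.sin (α u - β u) = 0 := fun u => by
    obtain ⟨n, hn⟩ := (hfα u).exists_sub_eq (hfβ u)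
    rw [hn, ← mul_assoc, Real.sin_eq_zero_iff]
    exact ⟨n * 2, by push_cast; ring⟩
  have h1 := mem_Icc_of_sin_sub_nonneg (c := 0) (hα.sub hβ)
    (fun u => by simp [hs]) (u₀ := u₀) (by simp [h₀, hπ.le]) u
  have h2 := mem_Icc_of_sin_sub_nonneg (c := -π) (hα.sub hβ)
    (fun u => by simp [hs, Real.sin_add_pi]) (u₀ := u₀) (by simp [h₀, hπ.le]) u
  simp only [Pi.sub_apply, Set.mem_Icc] at h1 h2
  linarith [h1.1, h2.2]

section HalfPlane

variable {f : ℝ → ℂ} {θ : ℝ → ℝ} {u₀ : ℝ}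

theorem mem_Icc_of_im_nonneg (hθ : Continuous θ) (hf : ∀ u, IsArg (f u) (θ u))
    (him : ∀ u, 0 ≤ (f u).im) (h₀ : θ u₀ ∈ Set.Icc 0 π) (u : ℝ) : θ u ∈ Set.Icc 0 π := by
  simpa using mem_Icc_of_sin_sub_nonneg (c := 0) hθ
    (fun u => by simpa using (hf u).sin_nonneg (him u)) (by simpa using h₀) u

theorem mem_Icc_of_im_nonpos (hθ : Continuous θ) (hf : ∀ u, IsArg (f u) (θ u))
    (him : ∀ u, (f u).im ≤ 0) (h₀ : θ u₀ ∈ Set.Icc (-π) 0) (u : ℝ) : θ u ∈ Set.Icc (-π) 0 := by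
  simpa using mem_Icc_of_sin_sub_nonneg (c := -π) hθ
    (fun u => by simpa [Real.sin_add_pi] using (hf u).sin_nonpos (him u)) (by simpa using h₀) u

theorem mem_Icc_pi_of_im_nonpos (hθ : Continuous θ) (hf : ∀ u, IsArg (f u) (θ u))
    (him : ∀ u, (f u).im ≤ 0) (h₀ : θ u₀ ∈ Set.Icc π (2 * π)) (u : ℝ) :
    θ u ∈ Set.Icc π (2 * π) := by
  rw [two_mul] at h₀ ⊢
  exact mem_Icc_of_sin_sub_nonneg hθ
    (fun u => by simpa [Real.sin_sub_pi] using (hf u).sin_nonpos (him u)) h₀ u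

theorem mem_Icc_of_re_nonneg (hθ : Continuous θ) (hf : ∀ u, IsArg (f u) (θ u))
    (hre : ∀ u, 0 ≤ (f u).re) (h₀ : θ u₀ ∈ Set.Icc (-(π / 2)) (π / 2)) (u : ℝ) :
    θ u ∈ Set.Icc (-(π / 2)) (π / 2) := by
  have hc : -(π / 2) + π = π / 2 := by ring
  have := mem_Icc_of_sin_sub_nonneg (c := -(π / 2)) hθ
    (fun u => by simpa [Real.sin_add_pi_div_two] using (hf u).cos_nonneg (hre u)) (by rwa [hc]) u
  rwa [hc] at this

theorem mem_Icc_of_re_nonpos (hθ : Continuous θ) (hf : ∀ u, IsArg (f u) (θ u))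
    (hre : ∀ u, (f u).re ≤ 0) (h₀ : θ u₀ ∈ Set.Icc (π / 2) (3 * π / 2)) (u : ℝ) :
    θ u ∈ Set.Icc (π / 2) (3 * π / 2) := by
  have hc : π / 2 + π = 3 * π / 2 := by ring
  rw [← hc] at h₀ ⊢
  exact mem_Icc_of_sin_sub_nonneg hθ
    (fun u => by simpa [Real.sin_sub_pi_div_two] using (hf u).cos_nonpos (hre u)) h₀ u

end HalfPlane

/-- A planar Poincaré-Miranda theorem: a continuous function with nonnegative and nonpositive real
part on two horizontal lines, and with nonnegative and nonpositive imaginary part on two vertical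
lines, has a zero. -/
theorem false_of_nonvanishing_square {f : ℝ × ℝ → ℂ} (hf : Continuous f) (h0 : ∀ p, f p ≠ 0)
    {u₁ u₂ t₁ t₂ : ℝ} (hright : ∀ u, 0 ≤ (f (u, t₁)).re) (hleft : ∀ u, (f (u, t₂)).re ≤ 0)
    (hup : ∀ t, 0 ≤ (f (u₁, t)).im) (hdown : ∀ t, (f (u₂, t)).im ≤ 0) : False := by
  have hπ := Real.pi_pos
  obtain ⟨θ, hθ, hθ₀, hθf⟩ := exists_continuous_isArg hf h0 (IsArg.of_arg (h0 (u₁, t₁)))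
  have hu : ∀ t, Continuous fun u => θ (u, t) := fun t => by fun_prop
  have ht : ∀ u, Continuous fun t => θ (u, t) := fun u => by fun_prop
  have e1 : θ (u₁, t₁) ∈ Set.Icc 0 (π / 2) := by
    rw [hθ₀]
    exact ⟨Complex.arg_nonneg_iff.2 (hup _), Complex.arg_le_pi_div_two_iff.2 (Or.inl (hright _))⟩
  have e2 := mem_Icc_of_re_nonneg (hu t₁) (fun u => hθf _) hright
    (u₀ := u₁) ⟨by linarith [e1.1], e1.2⟩ u₂
  have e3 := mem_Icc_of_im_nonneg (ht u₁) (fun t => hθf _) hup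
    (u₀ := t₁) ⟨e1.1, by linarith [e1.2]⟩ t₂
  have h2 : θ (u₂, t₁) ≤ 0 := by
    by_contra! h
    exact ((hθf (u₂, t₁)).sin_nonpos (hdown t₁)).not_gt
      (Real.sin_pos_of_pos_of_lt_pi h (by linarith [e2.2]))
  have h3 : π / 2 ≤ θ (u₁, t₂) := by
    by_contra! h
    exact ((hθf (u₁, t₂)).cos_nonpos (hleft u₁)).not_gt
      (Real.cos_pos_of_mem_Ioo ⟨by linarith [e3.1], h⟩)
  have e4 := mem_Icc_of_im_nonpos (ht u₂) (fun t => hθf _) hdown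
    (u₀ := t₁) ⟨by linarith [e2.1], h2⟩ t₂
  have e5 := mem_Icc_of_re_nonpos (hu t₂) (fun u => hθf _) hleft
    (u₀ := u₁) ⟨h3, by linarith [e3.2]⟩ u₂
  linarith [e4.2, e5.1]

/-- The case of the winding bound in which the second path stays above the lowest point of the
first one. Here `P` is a lift of the simple arc and `Q` a lift of the complementary arc. -/
theorem false_of_forall_im_le {P Q : ℝ → ℂ} (hP : Continuous P) (hQ : Continuous Q)
    {a b c d m : ℝ} {K : ℤ} (hK : 2 ≤ K) (hc : Q c = P a) (hd : Q d = P b - K)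
    (hF : ∀ n : ℤ, n ≠ 0 → ∀ s t, P s - P t ≠ n)
    (hE : ∀ n : ℤ, n ≠ 0 → n ≠ -K → ∀ u t, Q u ≠ P t + n)
    (hm : ∀ t, (P m).im ≤ (P t).im) (hQm : ∀ u, (P m).im ≤ (Q u).im)
    (hright : ∀ u, (Q u).re ≤ (P b).re - 1)
    (hleft : ∀ u, (P a).re - (K - 1) ≤ (Q u).re) : False := by
  have hπ := Real.pi_pos
  have hK' : (0 : ℝ) < K - 1 := by
    have : (2 : ℝ) ≤ K := by exact_mod_cast hK
    linarith
  obtain ⟨θ₁, hθ₁, hθ₁m, hθ₁f⟩ :=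
    exists_continuous_isArg (f := fun p : ℝ × ℝ => P p.1 - P p.2 - 1) (by fun_prop)
      (fun p h => hF 1 one_ne_zero p.1 p.2 (by rw [Int.cast_one, ← sub_eq_zero, h]))
      (p₀ := (m, m)) (φ := π) (by simpa using isArg_neg_of_pos one_pos)
  obtain ⟨θ₂, hθ₂, hθ₂m, hθ₂f⟩ :=
    exists_continuous_isArg (f := fun p : ℝ × ℝ => P p.1 - P p.2 - (K - 1)) (by fun_prop)
      (fun p h => hF (K - 1) (by omega) p.1 p.2 (by
        push_cast; rw [← sub_eq_zero, h]))
      (p₀ := (m, m)) (φ := π) (by simpa using isArg_neg_of_pos hK')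
  have hrow₁ := mem_Icc_of_im_nonneg (θ := fun s => θ₁ (s, m)) (by fun_prop)
    (fun s => hθ₁f (s, m)) (fun s => by simpa using hm s) (u₀ := m) (by simp [hθ₁m, hπ.le])
  have hcol₁ := mem_Icc_pi_of_im_nonpos (θ := fun t => θ₁ (m, t)) (by fun_prop)
    (fun t => hθ₁f (m, t)) (fun t => by simpa using hm t) (u₀ := m)
    (by rw [hθ₁m]; constructor <;> linarith)
  have hrow₂ := mem_Icc_of_im_nonneg (θ := fun s => θ₂ (s, m)) (by fun_prop)
    (fun s => hθ₂f (s, m)) (fun s => by simpa using hm s) (u₀ := m) (by simp [hθ₂m, hπ.le])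
  have hcol₂ := mem_Icc_pi_of_im_nonpos (θ := fun t => θ₂ (m, t)) (by fun_prop)
    (fun t => hθ₂f (m, t)) (fun t => by simpa using hm t) (u₀ := m)
    (by rw [hθ₂m]; constructor <;> linarith)
  have hdiag : ∀ t, θ₂ (t, t) = π :=
    eq_of_isArg_of_isArg (α := fun t => θ₂ (t, t)) (β := fun _ => π) (by fun_prop)
      continuous_const (fun t => hθ₂f (t, t))
      (fun t => by simpa using isArg_neg_of_pos hK') hθ₂m
  -- the argument of `Q u - P t + 1`
  have hE₁c : ∀ t, Q c - P t + 1 = -(P t - P a - 1) := fun t => by rw [hc]; ring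
  have hE₁d : ∀ t, Q d - P t + 1 = P b - P t - (K - 1) := fun t => by rw [hd]; ring
  obtain ⟨Φ₁, hΦ₁, hΦ₁c, hΦ₁f⟩ :=
    exists_continuous_isArg (f := fun p : ℝ × ℝ => Q p.1 - P p.2 + 1) (by fun_prop)
      (fun p h => hE (-1) (by omega) (by omega) p.1 p.2 (by
        push_cast; linear_combination h))
      (p₀ := (c, m)) (φ := θ₁ (m, a) - π) (by simpa only [hE₁c] using (hθ₁f (m, a)).neg)
  have h₁c : ∀ t, Φ₁ (c, t) = θ₁ (t, a) - π :=
    eq_of_isArg_of_isArg (α := fun t => Φ₁ (c, t)) (β := fun t => θ₁ (t, a) - π) (by fun_prop)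
      (by fun_prop) (fun t => hΦ₁f (c, t))
      (fun t => by simpa only [hE₁c] using (hθ₁f (t, a)).neg) hΦ₁c
  have h₁m := mem_Icc_of_im_nonneg (θ := fun u => Φ₁ (u, m)) (by fun_prop)
    (fun u => hΦ₁f (u, m)) (fun u => by simpa using hQm u) (u₀ := c)
    (by have := hcol₁ a; simp only [Set.mem_Icc] at this ⊢; rw [hΦ₁c]; constructor <;> linarith)
  have h₁d : ∀ t, Φ₁ (d, t) = θ₂ (b, t) :=
    eq_of_isArg_of_isArg (f := fun t => Q d - P t + 1) (α := fun t => Φ₁ (d, t))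
      (β := fun t => θ₂ (b, t)) (by fun_prop)
      (by fun_prop) (fun t => hΦ₁f (d, t))
      (fun t => by simpa only [hE₁d] using hθ₂f (b, t)) (u₀ := m)
      ((hΦ₁f (d, m)).eq_of_abs_sub_lt (by simpa only [hE₁d] using hθ₂f (b, m))
        (by
          have h1 := h₁m d
          have h2 := hrow₂ b
          simp only [Set.mem_Icc] at h1 h2
          rw [abs_lt]; constructor <;> linarith))
  have h₁b := mem_Icc_of_re_nonpos (θ := fun u => Φ₁ (u, b)) (by fun_prop)
    (fun u => hΦ₁f (u, b)) (fun u => by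
      have := hright u
      simp only [Complex.add_re, Complex.sub_re, Complex.one_re]
      linarith) (u₀ := d)
    (by simp only [h₁d, hdiag]; constructor <;> linarith) c
  -- the argument of `Q u - P t + (K - 1)`
  have hE₂c : ∀ t, Q c - P t + (K - 1) = -(P t - P a - (K - 1)) := fun t => by rw [hc]; ring
  have hE₂d : ∀ t, Q d - P t + (K - 1) = P b - P t - 1 := fun t => by rw [hd]; ring
  obtain ⟨Φ₂, hΦ₂, hΦ₂d, hΦ₂f⟩ :=
    exists_continuous_isArg (f := fun p : ℝ × ℝ => Q p.1 - P p.2 + (K - 1)) (by fun_prop)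
      (fun p h => hE (-(K - 1)) (by omega) (by omega) p.1 p.2 (by
        push_cast; linear_combination h))
      (p₀ := (d, m)) (φ := θ₁ (b, m)) (by simpa only [hE₂d] using hθ₁f (b, m))
  have h₂d : ∀ t, Φ₂ (d, t) = θ₁ (b, t) :=
    eq_of_isArg_of_isArg (α := fun t => Φ₂ (d, t)) (β := fun t => θ₁ (b, t)) (by fun_prop)
      (by fun_prop) (fun t => hΦ₂f (d, t))
      (fun t => by simpa only [hE₂d] using hθ₁f (b, t)) hΦ₂d
  have h₂m := mem_Icc_of_im_nonneg (θ := fun u => Φ₂ (u, m)) (by fun_prop)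
    (fun u => hΦ₂f (u, m)) (fun u => by simpa using hQm u) (u₀ := d)
    (by simpa only [hΦ₂d] using hrow₁ b)
  have h₂c : ∀ t, Φ₂ (c, t) = θ₂ (t, a) - π :=
    eq_of_isArg_of_isArg (f := fun t => Q c - P t + (K - 1)) (α := fun t => Φ₂ (c, t))
      (β := fun t => θ₂ (t, a) - π) (by fun_prop)
      (by fun_prop) (fun t => hΦ₂f (c, t))
      (fun t => by simpa only [hE₂c] using (hθ₂f (t, a)).neg) (u₀ := m)
      ((hΦ₂f (c, m)).eq_of_abs_sub_lt (by simpa only [hE₂c] using (hθ₂f (m, a)).neg)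
        (by
          have h1 := h₂m c
          have h2 := hcol₂ a
          simp only [Set.mem_Icc] at h1 h2
          rw [abs_lt]; constructor <;> linarith))
  have h₂a := mem_Icc_of_re_nonneg (θ := fun u => Φ₂ (u, a)) (by fun_prop)
    (fun u => hΦ₂f (u, a)) (fun u => by
      have := hleft u
      simp only [Complex.add_re, Complex.sub_re, Complex.one_re, Complex.intCast_re]
      linarith) (u₀ := c)
    (by simp only [h₂c, hdiag]; constructor <;> linarith) d
  simp only [h₁c, h₂d, Set.mem_Icc] at h₁b h₂a
  linarith [h₁b.1, h₂a.2]

/-- There are no continuous paths `P`, `Q` in the plane such that `Q` runs from the start of `P`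
to the translate by `-K` of its end, avoids all other integer translates of `P`, and stays
between the vertical lines through the translates of the two ends of `P` by `j`. -/
theorem false_of_integer_translates_disjoint {P Q : ℝ → ℂ} (hP : Continuous P) (hQ : Continuous Q)
    {a b c d m M : ℝ} {K j : ℤ} (hjK : -K < j) (hj0 : j < 0)
    (hc : Q c = P a) (hd : Q d = P b - K)
    (hF : ∀ n : ℤ, n ≠ 0 → ∀ s t, P s - P t ≠ n)
    (hE : ∀ n : ℤ, n ≠ 0 → n ≠ -K → ∀ u t, Q u ≠ P t + n)
    (hm : ∀ t, (P m).im ≤ (P t).im) (hM : ∀ t, (P t).im ≤ (P M).im)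
    (hleft : ∀ u, (P a).re + j ≤ (Q u).re) (hright : ∀ u, (Q u).re ≤ (P b).re + j) : False := by
  have hj1 : (j : ℝ) ≤ -1 := by exact_mod_cast Int.le_sub_one_of_lt hj0
  have hj2 : -(K : ℝ) + 1 ≤ j := by exact_mod_cast Int.add_one_le_of_lt hjK
  by_cases hlow : ∀ u, (P m).im ≤ (Q u).im
  · exact false_of_forall_im_le hP hQ (by omega) hc hd hF hE hm hlow
      (fun u => by linarith [hright u]) (fun u => by linarith [hleft u])
  by_cases hhigh : ∀ u, (Q u).im ≤ (P M).im
  · have hconj : ∀ (z w : ℂ) (n : ℤ), conj z = conj w + n → z = w + n := fun z w n h => by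
      simpa using congrArg conj h
    refine false_of_forall_im_le (P := fun t => conj (P t)) (Q := fun u => conj (Q u))
      (Complex.continuous_conj.comp hP) (Complex.continuous_conj.comp hQ)
      (a := a) (b := b) (c := c) (d := d) (m := M) (K := K) (by omega) (by rw [hc])
      (by simp [hd]) (fun n hn s t h => hF n hn s t ?_) (fun n hn hn' u t h => hE n hn hn' u t ?_)
      (fun t => by simpa using hM t) (fun u => by simpa using hhigh u)
      (fun u => by simpa using by linarith [hright u])
      (fun u => by simpa using by linarith [hleft u])
    · rw [sub_eq_iff_eq_add'] at h ⊢
      exact hconj _ _ _ h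
    · exact hconj _ _ _ h
  push Not at hlow hhigh
  obtain ⟨u₂, hu₂⟩ := hlow
  obtain ⟨u₁, hu₁⟩ := hhigh
  refine false_of_nonvanishing_square (f := fun p => Q p.1 - P p.2 - j) (by fun_prop)
    (fun p h => hE j hj0.ne (by omega) p.1 p.2 (by linear_combination h))
    (u₁ := u₁) (u₂ := u₂) (t₁ := a) (t₂ := b) (fun u => ?_) (fun u => ?_) (fun t => ?_)
    (fun t => ?_)
  · simpa using by linarith [hleft u]
  · simpa using by linarith [hright u]
  · simpa using by linarith [hM t]
  · simpa using by linarith [hm t]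

theorem τ_eq_τ_iff {x y : ℝ × ℝ} : τ x = τ y ↔ ∃ n : ℤ, x.1 = y.1 + n ∧ x.2 = y.2 := by
  have h : ((x.1 : 𝕊) = (y.1 : 𝕊)) ↔ ∃ n : ℤ, x.1 = y.1 + n := by
    rw [← sub_eq_zero, ← AddCircle.coe_sub, AddCircle.coe_eq_zero_iff]
    refine exists_congr fun n => ?_
    rw [zsmul_one]
    constructor <;> intro h <;> linarith
  simp only [τ, Prod.mk.injEq, h, exists_and_right]

theorem isBounded_fst_image {q : ℝ → ℝ × ℝ} {c d : ℝ} (hq : ContinuousOn q (Set.Icc c d)) :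
    Bornology.IsBounded (Prod.fst '' (q '' Set.Icc c d)) :=
  ((isCompact_Icc.image_of_continuousOn hq).image continuous_fst).isBounded

/-- The winding bound for arcs which only meet at their ends, without repetition. -/
theorem fst_sub_fst_le_diam_add_one {p q : ℝ → ℝ × ℝ} {a b c d : ℝ} (hab : a ≤ b) (hcd : c ≤ d)
    (hp : ContinuousOn p (Set.Icc a b)) (hq : ContinuousOn q (Set.Icc c d))
    (hinj : ∀ s ∈ Set.Icc a b, ∀ t ∈ Set.Icc a b, τ (p s) = τ (p t) → s = t)
    (hc : τ (q c) = τ (p a)) (hd : τ (q d) = τ (p b))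
    (hdisj : ∀ u ∈ Set.Icc c d, ∀ t ∈ Set.Icc a b, τ (q u) = τ (p t) →
      u = c ∧ t = a ∨ u = d ∧ t = b) :
    (p b).1 - (p a).1 ≤ Metric.diam (Prod.fst '' (q '' Set.Icc c d)) + 1 := by
  by_contra! hlt
  obtain ⟨N, hN, hN'⟩ := τ_eq_τ_iff.1 hc
  obtain ⟨N₁, hN₁, hN₁'⟩ := τ_eq_τ_iff.1 hd
  obtain ⟨v₀, hv₀, hmin⟩ := isCompact_Icc.exists_isMinOn (Set.nonempty_Icc.2 hcd) hq.fst
  obtain ⟨v₁, hv₁, hmax⟩ := isCompact_Icc.exists_isMaxOn (Set.nonempty_Icc.2 hcd) hq.fst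
  obtain ⟨m, hm, hpm⟩ := isCompact_Icc.exists_isMinOn (Set.nonempty_Icc.2 hab) hp.snd
  obtain ⟨M, hM, hpM⟩ := isCompact_Icc.exists_isMaxOn (Set.nonempty_Icc.2 hab) hp.snd
  have hD : (q v₁).1 - (q v₀).1 ≤ Metric.diam (Prod.fst '' (q '' Set.Icc c d)) :=
    (le_abs_self _).trans (Metric.dist_le_diam_of_mem (isBounded_fst_image hq)
      ⟨_, ⟨v₁, hv₁, rfl⟩, rfl⟩ ⟨_, ⟨v₀, hv₀, rfl⟩, rfl⟩)
  have hmin' : ∀ u ∈ Set.Icc c d, (q v₀).1 ≤ (q u).1 := fun u hu => hmin hu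
  have hmax' : ∀ u ∈ Set.Icc c d, (q u).1 ≤ (q v₁).1 := fun u hu => hmax hu
  have hcmem := Set.left_mem_Icc.2 hcd
  have hdmem := Set.right_mem_Icc.2 hcd
  obtain ⟨j, hj1, hj2⟩ : ∃ j : ℤ, (j : ℝ) < (q v₀).1 - N - (p a).1 ∧
      (q v₀).1 - N - (p a).1 ≤ j + 1 :=
    ⟨⌈(q v₀).1 - N - (p a).1⌉ - 1, by
      push_cast; linarith [Int.ceil_lt_add_one ((q v₀).1 - N - (p a).1)], by
      push_cast; linarith [Int.le_ceil ((q v₀).1 - N - (p a).1)]⟩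
  let ra := Set.projIcc a b hab
  let rc := Set.projIcc c d hcd
  have hra : Continuous fun t => p (ra t) := hp.domRestrict.comp continuous_projIcc
  have hrc : Continuous fun u => q (rc u) := hq.domRestrict.comp continuous_projIcc
  have hraa : (ra a : ℝ) = a := by simp [ra]
  have hrab : (ra b : ℝ) = b := by simp [ra]
  have hrcc : (rc c : ℝ) = c := by simp [rc]
  have hrcd : (rc d : ℝ) = d := by simp [rc]
  have hram : (ra m : ℝ) = m := by simp [ra, Set.projIcc_of_mem hab hm]
  have hraM : (ra M : ℝ) = M := by simp [ra, Set.projIcc_of_mem hab hM]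
  refine false_of_integer_translates_disjoint
    (P := fun t => Complex.equivRealProdCLM.symm (p (ra t)))
    (Q := fun u => Complex.equivRealProdCLM.symm (q (rc u)) - N)
    (Complex.equivRealProdCLM.symm.continuous.comp hra)
    ((Complex.equivRealProdCLM.symm.continuous.comp hrc).sub continuous_const) (a := a) (b := b)
    (c := c) (d := d) (m := m) (M := M) (K := N - N₁) (j := j) ?_ ?_ ?_ ?_ ?_ ?_ ?_ ?_ ?_ ?_
  · have h : -((N : ℝ) - N₁) < j := by linarith [hmax' d hdmem]
    exact_mod_cast h
  · have h : (j : ℝ) < 0 := by linarith [hmin' c hcmem]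
    exact_mod_cast h
  · apply Complex.ext <;> simp [hrcc, hraa, hN, hN']
  · apply Complex.ext
    · simp [hrcd, hrab, hN₁]
      ring
    · simp [hrcd, hrab, hN₁']
  · intro n hn s t h
    have h1 := congrArg Complex.re h
    have h2 := congrArg Complex.im h
    simp only [Complex.sub_re, Complex.sub_im, Complex.intCast_re, Complex.intCast_im,
      Complex.equivRealProdCLM_symm_apply_re, Complex.equivRealProdCLM_symm_apply_im] at h1 h2
    have h3 := hinj _ (ra s).2 _ (ra t).2 (τ_eq_τ_iff.2 ⟨n, by linarith, by linarith⟩)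
    rw [h3, sub_self] at h1
    exact hn (by exact_mod_cast h1.symm)
  · intro n hn hn' u t h
    have h1 := congrArg Complex.re h
    have h2 := congrArg Complex.im h
    simp only [Complex.sub_re, Complex.sub_im, Complex.add_re, Complex.add_im, Complex.intCast_re,
      Complex.intCast_im, Complex.equivRealProdCLM_symm_apply_re,
      Complex.equivRealProdCLM_symm_apply_im, sub_zero, add_zero] at h1 h2
    obtain ⟨h3, h4⟩ | ⟨h3, h4⟩ := hdisj _ (rc u).2 _ (ra t).2
      (τ_eq_τ_iff.2 ⟨n + N, by push_cast; linarith, h2⟩)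
    · rw [h3, h4] at h1
      exact hn (by exact_mod_cast (by linarith : (n : ℝ) = 0))
    · rw [h3, h4] at h1
      exact hn' (by exact_mod_cast (by linarith : (n : ℝ) = -(N - N₁)))
  · intro t
    simpa [hram] using hpm (ra t).2
  · intro t
    simpa [hraM] using hpM (ra t).2
  · intro u
    simpa [hraa] using by linarith [hmin' _ (rc u).2]
  · intro u
    simpa [hrab] using by linarith [hmax' _ (rc u).2]

/-- An arc from `x` to `y` contains a subarc from `x` to `y` which meets `{x, y}` only at its
ends. -/
theorem exists_subarc_meeting_ends_once {X : Type*} [TopologicalSpace X] [T1Space X]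
    {η : ℝ → X} {c d : ℝ} (hcd : c ≤ d) (hη : ContinuousOn η (Set.Icc c d)) :
    ∃ c' d', c ≤ c' ∧ c' ≤ d' ∧ d' ≤ d ∧ η c' = η c ∧ η d' = η d ∧
      (∀ u ∈ Set.Icc c' d', η u = η c → u = c') ∧ ∀ u ∈ Set.Icc c' d', η u = η d → u = d' := by
  have hcomp : ∀ {c' d' : ℝ} (x : X), ContinuousOn η (Set.Icc c' d') →
      IsCompact {u ∈ Set.Icc c' d' | η u = x} := fun x h =>
    isCompact_Icc.of_isClosed_subset
      (h.preimage_isClosed_of_isClosed isClosed_Icc isClosed_singleton) fun u hu => hu.1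
  obtain ⟨c', ⟨hc', hηc'⟩, hmax⟩ :=
    (hcomp (η c) hη).exists_isGreatest ⟨c, Set.left_mem_Icc.2 hcd, rfl⟩
  obtain ⟨d', ⟨hd', hηd'⟩, hmin⟩ :=
    (hcomp (η d) (hη.mono (Set.Icc_subset_Icc_left hc'.1))).exists_isLeast
      ⟨d, Set.right_mem_Icc.2 hc'.2, rfl⟩
  exact ⟨c', d', hc'.1, hd'.1, hd'.2, hηc', hηd',
    fun u hu h => le_antisymm (hmax ⟨⟨hc'.1.trans hu.1, hu.2.trans hd'.2⟩, h⟩) hu.1,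
    fun u hu h => le_antisymm hu.2 (hmin ⟨⟨hu.1, hu.2.trans hd'.2⟩, h⟩)⟩

theorem winding_le_diameter_add_one {σ η : ℝ → 𝔸} {σt ηt : ℝ → ℝ × ℝ} {a b c d : ℝ}
    (hab : a ≤ b) (hσinj : Set.InjOn σ (Set.Icc a b)) (hcd : c ≤ d)
    (hηc : ContinuousOn η (Set.Icc c d)) (hc : η c = σ a) (hd : η d = σ b)
    (hdisj : σ '' Set.Icc a b ∩ η '' Set.Icc c d ⊆ {σ a, σ b})
    (hσt : IsLiftOn σt σ a b) (hηt : IsLiftOn ηt η c d) :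
    W σt a b ≤ D ηt c d + 1 := by
  have ha := Set.left_mem_Icc.2 hab
  have hb := Set.right_mem_Icc.2 hab
  obtain ⟨c', d', hcc', hcd', hdd', hc', hd', honce_c, honce_d⟩ :=
    exists_subarc_meeting_ends_once hcd hηc
  rw [hc] at hc' honce_c
  rw [hd] at hd' honce_d
  have hsub : Set.Icc c' d' ⊆ Set.Icc c d := Set.Icc_subset_Icc hcc' hdd'
  have hτ : ∀ u ∈ Set.Icc c' d', τ (ηt u) = η u := fun u hu => hηt.2 u (hsub hu)
  have hmono : D ηt c' d' ≤ D ηt c d :=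
    Metric.diam_mono (Set.image_mono (Set.image_mono hsub)) (isBounded_fst_image hηt.1)
  refine (fst_sub_fst_le_diam_add_one hab hcd' hσt.1 (hηt.1.mono hsub) ?_ ?_ ?_ ?_).trans
    (add_le_add_left hmono 1)
  · intro s hs t ht h
    rw [hσt.2 s hs, hσt.2 t ht] at h
    exact hσinj hs ht h
  · rw [hτ _ (Set.left_mem_Icc.2 hcd'), hσt.2 a ha, hc']
  · rw [hτ _ (Set.right_mem_Icc.2 hcd'), hσt.2 b hb, hd']
  · intro u hu t ht h
    rw [hτ u hu, hσt.2 t ht] at h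
    obtain h' | h' := hdisj ⟨⟨t, ht, rfl⟩, ⟨u, hsub hu, h⟩⟩
    · exact Or.inl ⟨honce_c u hu (h.trans h'), hσinj ht ha h'⟩
    · exact Or.inr ⟨honce_d u hu (h.trans h'), hσinj ht hb h'⟩

section Reversal

variable {a b : ℝ}

theorem image_comp_add_sub_Icc {X : Type*} (f : ℝ → X) (a b : ℝ) :
    (fun s => f (a + b - s)) '' Set.Icc a b = f '' Set.Icc a b := by
  rw [← Function.comp_def f, Set.image_comp, Set.image_const_sub_Icc, add_sub_cancel_right,
    add_sub_cancel_left]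

theorem mapsTo_add_sub_Icc (a b : ℝ) :
    Set.MapsTo (fun s => a + b - s) (Set.Icc a b) (Set.Icc a b) := fun s hs =>
  ⟨by linarith [hs.2], by linarith [hs.1]⟩

theorem continuousOn_comp_add_sub {X : Type*} [TopologicalSpace X] {f : ℝ → X}
    (hf : ContinuousOn f (Set.Icc a b)) : ContinuousOn (fun s => f (a + b - s)) (Set.Icc a b) :=
  hf.comp (by fun_prop) (mapsTo_add_sub_Icc a b)

theorem injOn_comp_add_sub {X : Type*} {f : ℝ → X} (hf : Set.InjOn f (Set.Icc a b)) :
    Set.InjOn (fun s => f (a + b - s)) (Set.Icc a b) := fun _ hs _ ht h =>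
  sub_right_injective (hf (mapsTo_add_sub_Icc a b hs) (mapsTo_add_sub_Icc a b ht) h)

theorem IsLiftOn.reverse {σt : ℝ → ℝ × ℝ} {σ : ℝ → 𝔸} (h : IsLiftOn σt σ a b) :
    IsLiftOn (fun s => σt (a + b - s)) (fun s => σ (a + b - s)) a b :=
  ⟨continuousOn_comp_add_sub h.1, fun _ hs => h.2 _ (mapsTo_add_sub_Icc a b hs)⟩

theorem D_reverse (ηt : ℝ → ℝ × ℝ) (a b : ℝ) : D (fun s => ηt (a + b - s)) a b = D ηt a b := by
  rw [D, image_comp_add_sub_Icc, D]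

theorem W_reverse (σt : ℝ → ℝ × ℝ) (a b : ℝ) :
    W (fun s => σt (a + b - s)) a b = -W σt a b := by
  simp [W]

end Reversal

/-- The winding bound in absolute value, for arcs with matching orientations. -/
theorem abs_winding_le_diameter_add_one {σ η : ℝ → 𝔸} {σt ηt : ℝ → ℝ × ℝ} {a b c d : ℝ}
    (hab : a ≤ b) (hσinj : Set.InjOn σ (Set.Icc a b)) (hcd : c ≤ d)
    (hηc : ContinuousOn η (Set.Icc c d)) (hc : η c = σ a) (hd : η d = σ b)
    (hdisj : σ '' Set.Icc a b ∩ η '' Set.Icc c d ⊆ {σ a, σ b})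
    (hσt : IsLiftOn σt σ a b) (hηt : IsLiftOn ηt η c d) :
    |W σt a b| ≤ D ηt c d + 1 := by
  refine abs_le'.2 ⟨winding_le_diameter_add_one hab hσinj hcd hηc hc hd hdisj hσt hηt, ?_⟩
  rw [← W_reverse, ← D_reverse]
  refine winding_le_diameter_add_one hab (injOn_comp_add_sub hσinj) hcd
    (continuousOn_comp_add_sub hηc) (by simpa using hd) (by simpa using hc) ?_ hσt.reverse
    hηt.reverse
  rw [image_comp_add_sub_Icc, image_comp_add_sub_Icc]
  simpa [Set.pair_comm] using hdisj

end Auxiliary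

theorem winding_bounded_by_diameter_of_complementary_arc
    -- a simple arc `σ : [a,b] → 𝔸`:
    (a b : ℝ) (hab : a ≤ b)
    (σ : ℝ → 𝔸) (hσc : ContinuousOn σ (Set.Icc a b))
    (hσinj : Set.InjOn σ (Set.Icc a b))
    -- an arc `η : [c,d] → 𝔸` with the same two endpoints as `σ`:
    (c d : ℝ) (hcd : c ≤ d)
    (η : ℝ → 𝔸) (hηc : ContinuousOn η (Set.Icc c d))
    (hends : (η c = σ a ∧ η d = σ b) ∨ (η c = σ b ∧ η d = σ a))
    -- `η` is disjoint from `σ` except at the two endpoints: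
    (hdisj : σ '' Set.Icc a b ∩ η '' Set.Icc c d ⊆ {σ a, σ b})
    -- lifts:
    (σt : ℝ → ℝ × ℝ) (hσt : IsLiftOn σt σ a b)
    (ηt : ℝ → ℝ × ℝ) (hηt : IsLiftOn ηt η c d) :
    |W σt a b| ≤ D ηt c d + 1 := by
  obtain ⟨hc, hd⟩ | ⟨hc, hd⟩ := hends
  · exact abs_winding_le_diameter_add_one hab hσinj hcd hηc hc hd hdisj hσt hηt
  · rw [← D_reverse]
    exact abs_winding_le_diameter_add_one hab hσinj hcd (continuousOn_comp_add_sub hηc)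
      (by simpa using hd) (by simpa using hc) (by rwa [image_comp_add_sub_Icc]) hσt hηt.reverse
end
end

section
/- Let α and β be two disjoint simple arcs in 𝔸. Let σ₁ be an arc joining the initial point of α to the initial point of β and otherwise disjoint from α and β, and let σ₂ be an arc joining the final point of α to the final point of β and otherwise disjoint from α and β. Then |W(α) − W(β)| ≤ 2·D(σ₁) + 2·D(σ₂) + 2. -/
/- STATEMENT 12: If `α`, `β` are disjoint simple arcs in the annulus, `σ₁` is
an arc joining their initial points and otherwise disjoint from them, and `σ₂`
is an arc joining their final points and otherwise disjoint from them, then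
`|W(α) − W(β)| ≤ 2·D(σ₁) + 2·D(σ₂) + 2`.  Windings and homotopical diameters
are computed through arbitrary continuous lifts. -/

noncomputable section
open Set Metric Filter Topology Function

theorem angle_mem_Icc_of_sin_nonneg {φ : ℝ → ℝ} (hφ : Continuous φ) (h0 : φ 0 = 0)
    (hs : ∀ u ∈ Icc (0 : ℝ) 1, 0 ≤ Real.sin (φ u)) : φ 1 ∈ Icc 0 Real.pi := by
  have hpi := Real.pi_pos
  have ivt := intermediate_value_uIcc (a := (0 : ℝ)) (b := 1) hφ.continuousOn
  rw [h0, uIcc_of_le zero_le_one] at ivt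
  refine ⟨not_lt.1 fun hneg => ?_, not_lt.1 fun hbig => ?_⟩
  · obtain ⟨u, hu, hval⟩ := ivt (show max (φ 1) (-(Real.pi / 2)) ∈ uIcc 0 (φ 1) by
      rw [uIcc_of_ge hneg.le]
      exact ⟨le_max_left _ _, max_le hneg.le (by linarith)⟩)
    have := hs u hu
    have hlt := Real.sin_neg_of_neg_of_neg_pi_lt (x := φ u)
      (by rw [hval]; exact max_lt hneg (by linarith))
      (by rw [hval]; exact lt_max_of_lt_right (by linarith))
    linarith
  · obtain ⟨u, hu, hval⟩ := ivt (show min (φ 1) (Real.pi / 2 + Real.pi) ∈ uIcc 0 (φ 1) by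
      rw [uIcc_of_le (by linarith)]
      exact ⟨le_min (by linarith) (by linarith), min_le_left _ _⟩)
    have := hs u hu
    have hlt := Real.sin_pos_of_pos_of_lt_pi (x := φ u - Real.pi)
      (by rw [hval, sub_pos]; exact lt_min hbig (by linarith))
      (by rw [hval, sub_lt_iff_lt_add]; exact (min_le_right _ _).trans_lt (by linarith))
    rw [Real.sin_sub_pi] at hlt
    linarith

/-- A planar Poincaré–Miranda theorem for a field on the unit square whose second component is
nonpositive on two adjacent sides and nonnegative on the other two. -/
theorem exists_common_zero {f g : ℝ × ℝ → ℝ} (hf : Continuous f) (hg : Continuous g)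
    (hg1 : ∀ t ∈ Icc (0 : ℝ) 1, g (0, t) ≤ 0) (hg2 : ∀ s ∈ Icc (0 : ℝ) 1, g (s, 1) ≤ 0)
    (hg3 : ∀ s ∈ Icc (0 : ℝ) 1, 0 ≤ g (s, 0)) (hg4 : ∀ t ∈ Icc (0 : ℝ) 1, 0 ≤ g (1, t))
    (h0 : 0 < f (0, 0)) (h1 : f (1, 1) < 0) :
    ∃ s ∈ Icc (0 : ℝ) 1, ∃ t ∈ Icc (0 : ℝ) 1, f (s, t) = 0 ∧ g (s, t) = 0 := by
  by_contra! hne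
  let cl : ℝ → ℝ := fun x => max 0 (min 1 x)
  have hcl : Continuous cl := by fun_prop
  have hclm : ∀ x, cl x ∈ Icc (0 : ℝ) 1 := fun x =>
    ⟨le_max_left _ _, max_le zero_le_one (min_le_left _ _)⟩
  have hclid : ∀ x ∈ Icc (0 : ℝ) 1, cl x = x := fun x hx => by
    simp only [cl]; rw [min_eq_right hx.2, max_eq_right hx.1]
  let F : ℝ × ℝ → ℂ := fun p => (f (cl p.1, cl p.2) : ℂ) + (g (cl p.1, cl p.2) : ℂ) * Complex.I
  have hF : Continuous F := by fun_prop
  have hre : ∀ p, (F p).re = f (cl p.1, cl p.2) := fun p => by simp [F]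
  have him : ∀ p, (F p).im = g (cl p.1, cl p.2) := fun p => by simp [F]
  have hF0 : (0 : ℂ) ∉ F '' univ := by
    rintro ⟨p, -, hp⟩
    refine hne _ (hclm p.1) _ (hclm p.2) ?_ ?_
    · rw [← hre, hp]; rfl
    · rw [← him, hp]; rfl
  have hsc : IsSimplyConnected (univ : Set (ℝ × ℝ)) := by
    have := (convex_univ (𝕜 := ℝ) (E := ℝ × ℝ)).contractibleSpace univ_nonempty
    exact SimplyConnectedSpace.ofContractible _
  obtain ⟨L, hLc, hL⟩ := Complex.exists_continuousOn_eqOn_exp_comp hsc isOpen_univ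
    hF.continuousOn hF0
  rw [continuousOn_univ] at hLc
  have hcos : ∀ s ∈ Icc (0 : ℝ) 1, ∀ t ∈ Icc (0 : ℝ) 1,
      Real.exp (L (s, t)).re * Real.cos (L (s, t)).im = f (s, t) := fun s hs t ht => by
    rw [← Complex.exp_re, show Complex.exp (L (s, t)) = F (s, t) from hL (mem_univ _), hre]
    simp only [hclid s hs, hclid t ht]
  have hsin : ∀ s ∈ Icc (0 : ℝ) 1, ∀ t ∈ Icc (0 : ℝ) 1,
      Real.exp (L (s, t)).re * Real.sin (L (s, t)).im = g (s, t) := fun s hs t ht => by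
    rw [← Complex.exp_im, show Complex.exp (L (s, t)) = F (s, t) from hL (mem_univ _), him]
    simp only [hclid s hs, hclid t ht]
  have m0 : (0 : ℝ) ∈ Icc (0 : ℝ) 1 := by simp
  have m1 : (1 : ℝ) ∈ Icc (0 : ℝ) 1 := by simp
  have hsin0 : Real.sin (L (0, 0)).im = 0 := by
    have := hsin 0 m0 0 m0
    rw [le_antisymm (hg1 0 m0) (hg3 0 m0)] at this
    simpa using this
  have hcos0 : 0 < Real.cos (L (0, 0)).im := by
    have := hcos 0 m0 0 m0
    rw [← this] at h0
    exact (mul_pos_iff_of_pos_left (Real.exp_pos _)).1 h0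
  have hcos1 : Real.cos (L (1, 1)).im < 0 := by
    have := hcos 1 m1 1 m1
    rw [← this] at h1
    by_contra hc
    exact absurd h1 (not_lt.2 (mul_nonneg (Real.exp_pos _).le (not_lt.1 hc)))
  obtain ⟨n, hn⟩ : ∃ n : ℤ, (n : ℝ) * (2 * Real.pi) = (L (0, 0)).im := by
    rw [← Real.cos_eq_one_iff]
    nlinarith [Real.sin_sq_add_cos_sq (L (0, 0)).im]
  have hθs : ∀ p, Real.sin ((L p).im - (L (0, 0)).im) = Real.sin (L p).im := fun p => by
    rw [← hn, Real.sin_sub_int_mul_two_pi]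
  have hθc : ∀ p, Real.cos ((L p).im - (L (0, 0)).im) = Real.cos (L p).im := fun p => by
    rw [← hn, Real.cos_sub_int_mul_two_pi]
  have hpath : ∀ u ∈ Icc (0 : ℝ) 1, (u ≤ 1 / 2 ∧ cl (2 * u) = 2 * u ∧ cl (2 * u - 1) = 0) ∨
      (cl (2 * u) = 1 ∧ cl (2 * u - 1) ∈ Icc (0 : ℝ) 1) := by
    intro u hu
    rcases le_total u (1 / 2) with h | h
    · refine Or.inl ⟨h, hclid _ ⟨by linarith [hu.1], by linarith⟩, ?_⟩
      simp only [cl]; rw [max_eq_left]; exact min_le_of_right_le (by linarith)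
    · refine Or.inr ⟨?_, hclm _⟩
      simp only [cl]; rw [min_eq_left (by linarith), max_eq_right zero_le_one]
  have e0 : cl 0 = 0 := hclid 0 m0
  have e1 : cl 1 = 1 := hclid 1 m1
  have e2 : cl 2 = 1 := by simp [cl]
  have em : cl (-1) = 0 := by simp [cl]
  have up := angle_mem_Icc_of_sin_nonneg
    (φ := fun u => (L (cl (2 * u), cl (2 * u - 1))).im - (L (0, 0)).im)
    (by fun_prop) (by simp [e0, em]) (by
      intro u hu
      rw [hθs]
      have he := hsin _ (hclm (2 * u)) _ (hclm (2 * u - 1))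
      refine (mul_nonneg_iff_of_pos_left (Real.exp_pos _)).1 (he.trans_ge ?_)
      rcases hpath u hu with ⟨_, _, h⟩ | ⟨h, h'⟩
      · rw [h]; exact hg3 _ (hclm _)
      · rw [h]; exact hg4 _ h')
  have dn := angle_mem_Icc_of_sin_nonneg
    (φ := fun u => -((L (cl (2 * u - 1), cl (2 * u))).im - (L (0, 0)).im))
    (by fun_prop) (by simp [e0, em]) (by
      intro u hu
      rw [Real.sin_neg, hθs]
      have he := hsin _ (hclm (2 * u - 1)) _ (hclm (2 * u))
      refine neg_nonneg.2 (nonpos_of_mul_nonpos_right (he.trans_le ?_) (Real.exp_pos _))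
      rcases hpath u hu with ⟨_, _, h⟩ | ⟨h, h'⟩
      · rw [h]; exact hg1 _ (hclm _)
      · rw [h]; exact hg2 _ h')
  simp only [mul_one, show (2 : ℝ) - 1 = 1 by norm_num, e1, e2] at up dn
  have hz : (L (1, 1)).im - (L (0, 0)).im = 0 := le_antisymm (by linarith [dn.1]) up.1
  have := hθc (1, 1)
  rw [hz, Real.cos_zero] at this
  linarith

/-- Concatenating three paths, with the break points at times `1/4` and `1/2`. -/
theorem exists_continuous_concat {H T G : Set (ℝ × ℝ)} {z p q b : ℝ × ℝ}
    (hH : JoinedIn H z p) (hT : JoinedIn T p q) (hG : JoinedIn G q b) :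
    ∃ γ : ℝ → ℝ × ℝ, Continuous γ ∧ γ 0 = z ∧ γ (1 / 4) = p ∧ γ (1 / 2) = q ∧ γ 1 = b ∧
      (∀ s ∈ Icc (0 : ℝ) (1 / 4), γ s ∈ H) ∧ (∀ s ∈ Icc (1 / 4 : ℝ) (1 / 2), γ s ∈ T) ∧
      ∀ s ∈ Icc (1 / 2 : ℝ) 1, γ s ∈ G := by
  let γ := (hH.somePath.trans hT.somePath).trans hG.somePath
  have hext : ∀ s (hs : s ∈ Icc (0 : ℝ) 1), γ.extend s = γ ⟨s, hs⟩ := fun s hs =>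
    Path.extend_apply _ hs
  have hp : γ.extend (1 / 4) = p := by
    rw [hext _ (by norm_num), Path.trans_apply, dif_pos (by norm_num), Path.trans_apply,
      dif_pos (by norm_num)]
    convert hH.somePath.target using 2
    ext; norm_num
  have hq : γ.extend (1 / 2) = q := by
    rw [hext _ (by norm_num), Path.trans_apply, dif_pos (by norm_num)]
    convert (hH.somePath.trans hT.somePath).target using 2
    ext; norm_num
  refine ⟨γ.extend, γ.continuous_extend, γ.extend_zero, hp, hq, γ.extend_one, ?_, ?_, ?_⟩
  · intro s hs
    rw [hext s ⟨hs.1, by linarith [hs.2]⟩, Path.trans_apply,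
      dif_pos (show s ≤ 1 / 2 by linarith [hs.2]), Path.trans_apply,
      dif_pos (show 2 * s ≤ 1 / 2 by linarith [hs.2])]
    exact hH.somePath_mem _
  · intro s hs
    rcases hs.1.eq_or_lt with h | h
    · rw [← h, hp]; exact hT.source_mem
    rw [hext s ⟨by linarith [hs.1], by linarith [hs.2]⟩, Path.trans_apply,
      dif_pos (show s ≤ 1 / 2 by linarith [hs.2]), Path.trans_apply,
      dif_neg (show ¬ 2 * s ≤ 1 / 2 by linarith)]
    exact hT.somePath_mem _
  · intro s hs
    rcases hs.1.eq_or_lt with h | h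
    · rw [← h, hq]; exact hG.source_mem
    rw [hext s ⟨by linarith [hs.1], by linarith [hs.2]⟩, Path.trans_apply,
      dif_neg (show ¬ s ≤ 1 / 2 by linarith)]
    exact hG.somePath_mem _

/-- Two top-to-bottom curves in a horizontal strip whose heads `H₁, H₂` and whose ends `G₁, G₂`
are in opposite order must cross, and not only head with head or end with end. -/
theorem exists_mem_crossing {H₁ T₁ G₁ H₂ T₂ G₂ : Set (ℝ × ℝ)}
    {z₁ p₁ q₁ b₁ z₂ p₂ q₂ b₂ : ℝ × ℝ} {lo hi : ℝ}
    (hH₁ : JoinedIn H₁ z₁ p₁) (hT₁ : JoinedIn T₁ p₁ q₁) (hG₁ : JoinedIn G₁ q₁ b₁)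
    (hH₂ : JoinedIn H₂ z₂ p₂) (hT₂ : JoinedIn T₂ p₂ q₂) (hG₂ : JoinedIn G₂ q₂ b₂)
    (hstrip₁ : ∀ u ∈ H₁ ∪ T₁ ∪ G₁, u.2 ∈ Icc lo hi)
    (hstrip₂ : ∀ u ∈ H₂ ∪ T₂ ∪ G₂, u.2 ∈ Icc lo hi)
    (hz₁ : z₁.2 = hi) (hz₂ : z₂.2 = hi) (hb₁ : b₁.2 = lo) (hb₂ : b₂.2 = lo)
    (hH₁p : ∀ u ∈ H₁, u.1 < p₂.1) (hH₂p : ∀ u ∈ H₂, p₁.1 < u.1)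
    (hG₁q : ∀ u ∈ G₁, q₂.1 < u.1) (hG₂q : ∀ u ∈ G₂, u.1 < q₁.1) :
    ∃ u, (u ∈ H₁ ∧ (u ∈ T₂ ∨ u ∈ G₂)) ∨ (u ∈ T₁ ∧ (u ∈ H₂ ∨ u ∈ T₂ ∨ u ∈ G₂)) ∨
      (u ∈ G₁ ∧ (u ∈ H₂ ∨ u ∈ T₂)) := by
  obtain ⟨γ₁, hc₁, h₁z, h₁p, h₁q, h₁b, m₁H, m₁T, m₁G⟩ := exists_continuous_concat hH₁ hT₁ hG₁
  obtain ⟨γ₂, hc₂, h₂z, h₂p, h₂q, h₂b, m₂H, m₂T, m₂G⟩ := exists_continuous_concat hH₂ hT₂ hG₂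
  have s₁ : ∀ s ∈ Icc (0 : ℝ) 1, (γ₁ s).2 ∈ Icc lo hi := by
    intro s hs
    apply hstrip₁
    rcases le_total s (1 / 4) with h | h
    · exact Or.inl (Or.inl (m₁H s ⟨hs.1, h⟩))
    rcases le_total s (1 / 2) with h' | h'
    · exact Or.inl (Or.inr (m₁T s ⟨h, h'⟩))
    · exact Or.inr (m₁G s ⟨h', hs.2⟩)
  have s₂ : ∀ s ∈ Icc (0 : ℝ) 1, (γ₂ s).2 ∈ Icc lo hi := by
    intro s hs
    apply hstrip₂
    rcases le_total s (1 / 4) with h | h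
    · exact Or.inl (Or.inl (m₂H s ⟨hs.1, h⟩))
    rcases le_total s (1 / 2) with h' | h'
    · exact Or.inl (Or.inr (m₂T s ⟨h, h'⟩))
    · exact Or.inr (m₂G s ⟨h', hs.2⟩)
  obtain ⟨s, hs, t, ht, hf, hg⟩ := exists_common_zero
    (f := fun x => min (max ((γ₂ x.2).1 - (γ₁ x.1).1) (min (1 / 4 - x.1) (1 / 4 - x.2)))
      (-min (x.1 - 1 / 2) (x.2 - 1 / 2)))
    (g := fun x => (γ₂ x.2).2 - (γ₁ x.1).2) (by fun_prop) (by fun_prop)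
    (fun t ht => by simp only [h₁z, hz₁]; linarith [(s₂ t ht).2])
    (fun s hs => by simp only [h₂b, hb₂]; linarith [(s₁ s hs).1])
    (fun s hs => by simp only [h₂z, hz₂]; linarith [(s₁ s hs).2])
    (fun t ht => by simp only [h₁b, hb₁]; linarith [(s₂ t ht).1])
    (by refine lt_min (lt_max_of_lt_right ?_) ?_ <;> norm_num)
    (by refine min_lt_of_right_lt ?_; norm_num)
  simp only at hf hg
  have hneg : ∀ x : ℝ, 0 < x → ∀ y, min y x = 0 → y = 0 := fun x hx y h => by
    rcases min_choice y x with h' | h' <;> rw [h'] at h <;> linarith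
  by_cases htop : s ≤ 1 / 4 ∧ t ≤ 1 / 4
  · exfalso
    have hmax := hneg _ (by
      rw [neg_pos]; exact min_lt_of_left_lt (by linarith [htop.1])) _ hf
    have hle := hmax.le
    rw [max_le_iff, min_le_iff] at hle
    rcases hle.2 with h | h
    · obtain rfl : s = 1 / 4 := by linarith [htop.1]
      linarith [hH₂p _ (m₂H t ⟨ht.1, htop.2⟩), congrArg Prod.fst h₁p]
    · obtain rfl : t = 1 / 4 := by linarith [htop.2]
      linarith [hH₁p _ (m₁H s ⟨hs.1, htop.1⟩), congrArg Prod.fst h₂p]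
  by_cases hbot : 1 / 2 ≤ s ∧ 1 / 2 ≤ t
  · exfalso
    have hle := hf.ge
    rw [le_min_iff, le_max_iff, neg_nonneg, min_le_iff] at hle
    have hf0 : 0 ≤ (γ₂ t).1 - (γ₁ s).1 := by
      refine hle.1.resolve_right fun h => ?_
      rw [le_min_iff] at h
      linarith [hbot.1]
    rcases hle.2 with h | h
    · obtain rfl : s = 1 / 2 := by linarith [hbot.1]
      linarith [hG₂q _ (m₂G t ⟨hbot.2, ht.2⟩), congrArg Prod.fst h₁q]
    · obtain rfl : t = 1 / 2 := by linarith [hbot.2]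
      linarith [hG₁q _ (m₁G s ⟨hbot.1, hs.2⟩), congrArg Prod.fst h₂q]
  have hmax := hneg _ (by
    rw [neg_pos, min_lt_iff]
    by_contra! h
    exact hbot ⟨by linarith [h.1], by linarith [h.2]⟩) _ hf
  have hψ : min (1 / 4 - s) (1 / 4 - t) < 0 := by
    rw [min_lt_iff]
    by_contra! h
    exact htop ⟨by linarith [h.1], by linarith [h.2]⟩
  have hf0 : (γ₂ t).1 - (γ₁ s).1 = 0 := by
    rcases max_choice ((γ₂ t).1 - (γ₁ s).1) (min (1 / 4 - s) (1 / 4 - t)) with h | h <;>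
      rw [h] at hmax <;> linarith
  have heq : γ₂ t = γ₁ s := Prod.ext (by linarith) (by linarith)
  refine ⟨γ₁ s, ?_⟩
  rcases le_total s (1 / 4) with h | h
  · have h4 : 1 / 4 < t := not_le.1 fun h' => htop ⟨h, h'⟩
    refine Or.inl ⟨m₁H s ⟨hs.1, h⟩, ?_⟩
    rw [← heq]
    rcases le_total t (1 / 2) with h' | h'
    · exact Or.inl (m₂T t ⟨h4.le, h'⟩)
    · exact Or.inr (m₂G t ⟨h', ht.2⟩)
  rcases le_total s (1 / 2) with h' | h'
  · refine Or.inr (Or.inl ⟨m₁T s ⟨h, h'⟩, ?_⟩)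
    rw [← heq]
    rcases le_total t (1 / 4) with k | k
    · exact Or.inl (m₂H t ⟨ht.1, k⟩)
    rcases le_total t (1 / 2) with k' | k'
    · exact Or.inr (Or.inl (m₂T t ⟨k, k'⟩))
    · exact Or.inr (Or.inr (m₂G t ⟨k', ht.2⟩))
  · have h2 : t < 1 / 2 := not_le.1 fun k => hbot ⟨h', k⟩
    refine Or.inr (Or.inr ⟨m₁G s ⟨h', hs.2⟩, ?_⟩)
    rw [← heq]
    rcases le_total t (1 / 4) with k | k
    · exact Or.inl (m₂H t ⟨ht.1, k⟩)
    · exact Or.inr (m₂T t ⟨k, h2.le⟩)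

/-- Two top-to-bottom curves in a horizontal strip whose ends are in opposite order meet. -/
theorem inter_nonempty_of_crossing {S₁ S₂ : Set (ℝ × ℝ)} {z₁ b₁ z₂ b₂ : ℝ × ℝ} {lo hi : ℝ}
    (h₁ : JoinedIn S₁ z₁ b₁) (h₂ : JoinedIn S₂ z₂ b₂)
    (hstrip₁ : ∀ u ∈ S₁, u.2 ∈ Icc lo hi) (hstrip₂ : ∀ u ∈ S₂, u.2 ∈ Icc lo hi)
    (hz₁ : z₁.2 = hi) (hz₂ : z₂.2 = hi) (hb₁ : b₁.2 = lo) (hb₂ : b₂.2 = lo)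
    (hz : z₁.1 < z₂.1) (hb : b₂.1 < b₁.1) : (S₁ ∩ S₂).Nonempty := by
  have hsub : ∀ {S : Set (ℝ × ℝ)} {z b}, JoinedIn S z b → ∀ u ∈ {z} ∪ S ∪ {b}, u ∈ S := by
    rintro S z b h u ((rfl | hu) | rfl)
    exacts [h.source_mem, hu, h.target_mem]
  obtain ⟨u, hu⟩ := exists_mem_crossing (H₁ := {z₁}) (G₁ := {b₁}) (H₂ := {z₂}) (G₂ := {b₂})
    (JoinedIn.refl rfl) h₁ (JoinedIn.refl rfl) (JoinedIn.refl rfl) h₂ (JoinedIn.refl rfl)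
    (fun u hu => hstrip₁ u (hsub h₁ u hu)) (fun u hu => hstrip₂ u (hsub h₂ u hu))
    hz₁ hz₂ hb₁ hb₂ (by simpa) (by simpa) (by simpa) (by simpa)
  have m₁ := hsub h₁ u
  have m₂ := hsub h₂ u
  simp only [mem_union] at m₁ m₂
  exact ⟨u, m₁ (by tauto), m₂ (by tauto)⟩

/-- Horizontal translation of the plane by an integer. -/
def shiftPoint (i : ℤ) (x : ℝ × ℝ) : ℝ × ℝ := (x.1 + i, x.2)

/-- The image of a plane set under horizontal translation by an integer. -/
def shift (i : ℤ) (A : Set (ℝ × ℝ)) : Set (ℝ × ℝ) := {x | (x.1 - i, x.2) ∈ A}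

theorem mem_shift_iff {i : ℤ} {A : Set (ℝ × ℝ)} {u : ℝ × ℝ} :
    u ∈ shift i A ↔ (u.1 - (i : ℝ), u.2) ∈ A := Iff.rfl

theorem mem_shift_zero {A : Set (ℝ × ℝ)} {u : ℝ × ℝ} : u ∈ shift 0 A ↔ u ∈ A := by
  simp [mem_shift_iff]

theorem mem_shift_shift {A : Set (ℝ × ℝ)} {i j : ℤ} {u : ℝ × ℝ} :
    u ∈ shift i (shift j A) ↔ u ∈ shift (i + j) A := by
  simp only [mem_shift_iff, Int.cast_add]
  rw [sub_sub]

theorem shiftPoint_mem_shift {A : Set (ℝ × ℝ)} {i : ℤ} {u : ℝ × ℝ} :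
    shiftPoint i u ∈ shift i A ↔ u ∈ A := by
  simp [mem_shift_iff, shiftPoint]

theorem continuous_shiftPoint (i : ℤ) : Continuous (shiftPoint i) := by
  unfold shiftPoint; fun_prop

theorem shift_eq_image (i : ℤ) (A : Set (ℝ × ℝ)) : shift i A = shiftPoint i '' A := by
  ext u
  refine ⟨fun h => ⟨_, h, by simp [shiftPoint]⟩, ?_⟩
  rintro ⟨x, hx, rfl⟩
  exact shiftPoint_mem_shift.2 hx

theorem isPathConnected_shift {A : Set (ℝ × ℝ)} (h : IsPathConnected A) (i : ℤ) :
    IsPathConnected (shift i A) := by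
  rw [shift_eq_image]
  exact h.image (continuous_shiftPoint i)

/-- If a top-to-bottom curve `Λ` of a strip can only meet a translate of the path connected set
`A` when it also lies above or below that copy of `P` or `Q`, then `Q` is not much farther to
the right than `P`. -/
theorem sub_le_of_curve {Λ A : Set (ℝ × ℝ)} {z b P Q : ℝ × ℝ} {lo hi E : ℝ}
    (hΛ : JoinedIn Λ z b) (hz : z.2 = hi) (hb : b.2 = lo)
    (hΛs : ∀ u ∈ Λ, u.2 ∈ Icc lo hi) (hE : ∀ x ∈ Λ, ∀ y ∈ Λ, x.1 - y.1 ≤ E)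
    (hA : IsPathConnected A) (hAs : ∀ u ∈ A, u.2 ∈ Icc lo hi) (hP : P ∈ A) (hQ : Q ∈ A)
    (hmeet : ∀ i : ℤ, ∀ x ∈ Λ, x ∈ shift i A → ∃ y ∈ Λ, y.1 = P.1 + i ∨ y.1 = Q.1 + i) :
    Q.1 - P.1 ≤ E + 1 := by
  by_contra! hlt
  have hne : (Prod.fst '' Λ).Nonempty := ⟨_, mem_image_of_mem _ hΛ.source_mem⟩
  have hbdd : BddAbove (Prod.fst '' Λ) := by
    refine ⟨z.1 + E, ?_⟩
    rintro _ ⟨x, hx, rfl⟩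
    linarith [hE x hx z hΛ.source_mem]
  set s := sSup (Prod.fst '' Λ)
  set i : ℤ := ⌊s - Q.1⌋ + 1 with hi'
  have hi1 : s - Q.1 < i := by rw [hi']; push_cast; exact Int.lt_floor_add_one _
  have hi2 : (i : ℝ) ≤ s - Q.1 + 1 := by
    rw [hi']; push_cast; linarith [Int.floor_le (s - Q.1)]
  have hright : ∀ x ∈ Λ, x.1 < Q.1 + i := fun x hx => by
    linarith [le_csSup hbdd (mem_image_of_mem Prod.fst hx)]
  have hleft : ∀ x ∈ Λ, P.1 + i < x.1 := fun x hx => by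
    have : s ≤ x.1 + E := by
      refine csSup_le hne ?_
      rintro _ ⟨y, hy, rfl⟩
      linarith [hE y hy x hx]
    linarith
  have hvert : ∀ c u v : ℝ, u ∈ Icc lo hi → v ∈ Icc lo hi →
      JoinedIn ({c} ×ˢ Icc lo hi : Set (ℝ × ℝ)) (c, u) (c, v) := fun c u v hu hv =>
    (((convex_singleton c).prod (convex_Icc lo hi)).isPathConnected ⟨(c, u), mem_singleton _, hu⟩).joinedIn
      _ ⟨mem_singleton _, hu⟩ _ ⟨mem_singleton _, hv⟩
  have hlohi : lo ≤ hi := (hAs P hP).1.trans (hAs P hP).2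
  let V₁ : Set (ℝ × ℝ) := {P.1 + i} ×ˢ Icc lo hi
  let V₂ : Set (ℝ × ℝ) := {Q.1 + i} ×ˢ Icc lo hi
  have j₁ : JoinedIn (V₁ ∪ shift i A ∪ V₂) (P.1 + i, hi) (Q.1 + i, lo) :=
    (((hvert _ _ _ ⟨hlohi, le_rfl⟩ (hAs P hP)).mono fun u hu => Or.inl (Or.inl hu)).trans
      (((isPathConnected_shift hA i).joinedIn (shiftPoint i P) (shiftPoint_mem_shift.2 hP) (shiftPoint i Q)
        (shiftPoint_mem_shift.2 hQ)).mono fun u hu => Or.inl (Or.inr hu))).trans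
      ((hvert _ _ _ (hAs Q hQ) ⟨le_rfl, hlohi⟩).mono fun u hu => Or.inr hu)
  obtain ⟨u, hu, huΛ⟩ := inter_nonempty_of_crossing j₁ hΛ (lo := lo) (hi := hi)
    (by
      rintro u ((⟨-, hu⟩ | hu) | ⟨-, hu⟩)
      exacts [hu, hAs (u.1 - i, u.2) hu, hu])
    hΛs rfl hz rfl hb (hleft _ hΛ.source_mem) (hright _ hΛ.target_mem)
  rcases hu with (⟨hu, -⟩ | hu) | ⟨hu, -⟩
  · exact (hleft u huΛ).ne' hu
  · obtain ⟨y, hy, h | h⟩ := hmeet i u huΛ hu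
    · exact (hleft y hy).ne' h
    · exact (hright y hy).ne h
  · exact (hright u huΛ).ne hu

/-- Lifts to the plane of the configuration of two disjoint arcs `A` (from `P` to `Q`) and `B`
(from `P'` to `Q'`) of the annulus and two connecting arcs: `S` joins `P` to `P'`, and `R` joins
`Q` to `Q' + (k, 0)`. -/
structure LinkedArcs (A B S R : Set (ℝ × ℝ)) (P Q P' Q' : ℝ × ℝ) (k : ℤ) (d₁ d₂ lo hi : ℝ) :
    Prop where
  connA : IsPathConnected A
  connB : IsPathConnected B
  connS : IsPathConnected S
  connR : IsPathConnected R
  PA : P ∈ A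
  QA : Q ∈ A
  PB : P' ∈ B
  QB : Q' ∈ B
  PS : P ∈ S
  PS' : P' ∈ S
  QR : Q ∈ R
  QR' : Q' ∈ shift (-k) R
  AA : ∀ i j u, u ∈ shift i A → u ∈ shift j A → i = j
  BB : ∀ i j u, u ∈ shift i B → u ∈ shift j B → i = j
  AB : ∀ i j u, u ∈ shift i A → u ∉ shift j B
  SA : ∀ i j u, u ∈ shift i S → u ∈ shift j A → i = j
  SB : ∀ i j u, u ∈ shift i S → u ∈ shift j B → i = j
  RA : ∀ i j u, u ∈ shift i R → u ∈ shift j A → i = j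
  RB : ∀ i j u, u ∈ shift i R → u ∈ shift j B → i + k = j
  widthS : ∀ x ∈ S, ∀ y ∈ S, x.1 - y.1 ≤ d₁
  widthR : ∀ x ∈ R, ∀ y ∈ R, x.1 - y.1 ≤ d₂
  stripA : ∀ u ∈ A, u.2 ∈ Icc lo hi
  stripB : ∀ u ∈ B, u.2 ∈ Icc lo hi
  stripS : ∀ u ∈ S, u.2 ∈ Icc lo hi
  stripR : ∀ u ∈ R, u.2 ∈ Icc lo hi

/-- Reflection of the plane in the vertical axis. -/
def flipX (x : ℝ × ℝ) : ℝ × ℝ := (-x.1, x.2)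

/-- Reflection of the plane in the horizontal axis. -/
def flipY (x : ℝ × ℝ) : ℝ × ℝ := (x.1, -x.2)

theorem flipX_flipX (x : ℝ × ℝ) : flipX (flipX x) = x := by simp [flipX]

theorem flipY_flipY (x : ℝ × ℝ) : flipY (flipY x) = x := by simp [flipY]

theorem mem_shift_flipX {i : ℤ} {A : Set (ℝ × ℝ)} {u : ℝ × ℝ} :
    u ∈ shift i (flipX ⁻¹' A) ↔ flipX u ∈ shift (-i) A := by
  simp only [mem_shift_iff, mem_preimage, flipX, Int.cast_neg]
  rw [show -(u.1 - (i : ℝ)) = -u.1 - -(i : ℝ) by ring]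

theorem mem_shift_flipY {i : ℤ} {A : Set (ℝ × ℝ)} {u : ℝ × ℝ} :
    u ∈ shift i (flipY ⁻¹' A) ↔ flipY u ∈ shift i A := Iff.rfl

theorem isPathConnected_flipX {A : Set (ℝ × ℝ)} (h : IsPathConnected A) :
    IsPathConnected (flipX ⁻¹' A) := by
  rw [← image_eq_preimage_of_inverse flipX_flipX flipX_flipX]
  exact h.image (by unfold flipX; fun_prop)

theorem isPathConnected_flipY {A : Set (ℝ × ℝ)} (h : IsPathConnected A) :
    IsPathConnected (flipY ⁻¹' A) := by
  rw [← image_eq_preimage_of_inverse flipY_flipY flipY_flipY]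
  exact h.image (by unfold flipY; fun_prop)

theorem mem_strip_of_mem_shift {A : Set (ℝ × ℝ)} {lo hi : ℝ} (h : ∀ u ∈ A, u.2 ∈ Icc lo hi)
    {i : ℤ} {u : ℝ × ℝ} (hu : u ∈ shift i A) : u.2 ∈ Icc lo hi :=
  h (u.1 - i, u.2) hu

theorem sub_le_of_mem_shift {A : Set (ℝ × ℝ)} {d : ℝ} (h : ∀ x ∈ A, ∀ y ∈ A, x.1 - y.1 ≤ d)
    {i j : ℤ} {u v : ℝ × ℝ} (hu : u ∈ shift i A) (hv : v ∈ shift j A) :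
    (u.1 - i) - (v.1 - j) ≤ d :=
  h _ hu _ hv

theorem joinedIn_shift {A : Set (ℝ × ℝ)} (h : IsPathConnected A) {i : ℤ} {u v : ℝ × ℝ}
    (hu : u ∈ A) (hv : v ∈ A) : JoinedIn (shift i A) (shiftPoint i u) (shiftPoint i v) :=
  (isPathConnected_shift h i).joinedIn _ (shiftPoint_mem_shift.2 hu) _ (shiftPoint_mem_shift.2 hv)

theorem exists_flipX {A : Set (ℝ × ℝ)} {c : ℝ} (h : ∃ z ∈ A, z.2 = c) :
    ∃ z ∈ flipX ⁻¹' A, z.2 = c := by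
  obtain ⟨z, hz, hc⟩ := h
  exact ⟨flipX z, by rwa [mem_preimage, flipX_flipX], hc⟩

theorem exists_flipY {A : Set (ℝ × ℝ)} {c : ℝ} (h : ∃ z ∈ A, z.2 = c) :
    ∃ z ∈ flipY ⁻¹' A, z.2 = -c := by
  obtain ⟨z, hz, hc⟩ := h
  exact ⟨flipY z, by rwa [mem_preimage, flipY_flipY], by simp [flipY, hc]⟩

theorem exists_shift {A : Set (ℝ × ℝ)} {c : ℝ} (i : ℤ) (h : ∃ z ∈ A, z.2 = c) :
    ∃ z ∈ shift i A, z.2 = c := by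
  obtain ⟨z, hz, hc⟩ := h
  exact ⟨shiftPoint i z, shiftPoint_mem_shift.2 hz, hc⟩

namespace LinkedArcs

variable {A B S R : Set (ℝ × ℝ)} {P Q P' Q' : ℝ × ℝ} {k : ℤ} {d₁ d₂ lo hi : ℝ}

theorem swap (h : LinkedArcs A B S R P Q P' Q' k d₁ d₂ lo hi) :
    LinkedArcs B A S (shift (-k) R) P' Q' P Q (-k) d₁ d₂ lo hi where
  connA := h.connB
  connB := h.connA
  connS := h.connS
  connR := isPathConnected_shift h.connR _
  PA := h.PB
  QA := h.QB
  PB := h.PA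
  QB := h.QA
  PS := h.PS'
  PS' := h.PS
  QR := h.QR'
  QR' := by rw [mem_shift_shift, neg_neg, add_neg_cancel, mem_shift_zero]; exact h.QR
  AA := h.BB
  BB := h.AA
  AB := fun i j u hi hj => h.AB j i u hj hi
  SA := h.SB
  SB := h.SA
  RA := fun i j u hi hj => by have := h.RB _ j u (mem_shift_shift.1 hi) hj; omega
  RB := fun i j u hi hj => by have := h.RA _ j u (mem_shift_shift.1 hi) hj; omega
  widthS := h.widthS
  widthR := fun x hx y hy => by linarith [sub_le_of_mem_shift h.widthR hx hy]
  stripA := h.stripB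
  stripB := h.stripA
  stripS := h.stripS
  stripR := fun u hu => mem_strip_of_mem_shift h.stripR hu

theorem reverse (h : LinkedArcs A B S R P Q P' Q' k d₁ d₂ lo hi) :
    LinkedArcs A (shift k B) R S Q P (shiftPoint k Q') (shiftPoint k P') (-k) d₂ d₁ lo hi where
  connA := h.connA
  connB := isPathConnected_shift h.connB _
  connS := h.connR
  connR := h.connS
  PA := h.QA
  QA := h.PA
  PB := shiftPoint_mem_shift.2 h.QB
  QB := shiftPoint_mem_shift.2 h.PB
  PS := h.QR
  PS' := by
    have := shiftPoint_mem_shift (i := k).2 h.QR'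
    rwa [mem_shift_shift, add_neg_cancel, mem_shift_zero] at this
  QR := h.PS
  QR' := by rw [neg_neg]; exact shiftPoint_mem_shift.2 h.PS'
  AA := h.AA
  BB := fun i j u hi hj => by
    have := h.BB _ _ u (mem_shift_shift.1 hi) (mem_shift_shift.1 hj); omega
  AB := fun i j u hi hj => h.AB _ _ u hi (mem_shift_shift.1 hj)
  SA := h.RA
  SB := fun i j u hi hj => by have := h.RB _ _ u hi (mem_shift_shift.1 hj); omega
  RA := h.SA
  RB := fun i j u hi hj => by have := h.SB _ _ u hi (mem_shift_shift.1 hj); omega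
  widthS := h.widthR
  widthR := h.widthS
  stripA := h.stripA
  stripB := fun u hu => mem_strip_of_mem_shift h.stripB hu
  stripS := h.stripR
  stripR := h.stripS

theorem reflectX (h : LinkedArcs A B S R P Q P' Q' k d₁ d₂ lo hi) :
    LinkedArcs (flipX ⁻¹' A) (flipX ⁻¹' B) (flipX ⁻¹' S) (flipX ⁻¹' R) (flipX P) (flipX Q)
      (flipX P') (flipX Q') (-k) d₁ d₂ lo hi where
  connA := isPathConnected_flipX h.connA
  connB := isPathConnected_flipX h.connB
  connS := isPathConnected_flipX h.connS
  connR := isPathConnected_flipX h.connR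
  PA := by rw [mem_preimage, flipX_flipX]; exact h.PA
  QA := by rw [mem_preimage, flipX_flipX]; exact h.QA
  PB := by rw [mem_preimage, flipX_flipX]; exact h.PB
  QB := by rw [mem_preimage, flipX_flipX]; exact h.QB
  PS := by rw [mem_preimage, flipX_flipX]; exact h.PS
  PS' := by rw [mem_preimage, flipX_flipX]; exact h.PS'
  QR := by rw [mem_preimage, flipX_flipX]; exact h.QR
  QR' := by rw [mem_shift_flipX, flipX_flipX, neg_neg]; exact h.QR'
  AA := fun i j u hi hj => neg_injective (h.AA _ _ _ (mem_shift_flipX.1 hi) (mem_shift_flipX.1 hj))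
  BB := fun i j u hi hj => neg_injective (h.BB _ _ _ (mem_shift_flipX.1 hi) (mem_shift_flipX.1 hj))
  AB := fun i j u hi hj => h.AB _ _ _ (mem_shift_flipX.1 hi) (mem_shift_flipX.1 hj)
  SA := fun i j u hi hj => neg_injective (h.SA _ _ _ (mem_shift_flipX.1 hi) (mem_shift_flipX.1 hj))
  SB := fun i j u hi hj => neg_injective (h.SB _ _ _ (mem_shift_flipX.1 hi) (mem_shift_flipX.1 hj))
  RA := fun i j u hi hj => neg_injective (h.RA _ _ _ (mem_shift_flipX.1 hi) (mem_shift_flipX.1 hj))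
  RB := fun i j u hi hj => by
    have := h.RB _ _ _ (mem_shift_flipX.1 hi) (mem_shift_flipX.1 hj); omega
  widthS := fun x hx y hy => by
    have := h.widthS _ hy _ hx
    simp only [flipX] at this
    linarith
  widthR := fun x hx y hy => by
    have := h.widthR _ hy _ hx
    simp only [flipX] at this
    linarith
  stripA := fun u hu => h.stripA (flipX u) hu
  stripB := fun u hu => h.stripB (flipX u) hu
  stripS := fun u hu => h.stripS (flipX u) hu
  stripR := fun u hu => h.stripR (flipX u) hu

theorem reflectY (h : LinkedArcs A B S R P Q P' Q' k d₁ d₂ lo hi) :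
    LinkedArcs (flipY ⁻¹' A) (flipY ⁻¹' B) (flipY ⁻¹' S) (flipY ⁻¹' R) (flipY P) (flipY Q)
      (flipY P') (flipY Q') k d₁ d₂ (-hi) (-lo) where
  connA := isPathConnected_flipY h.connA
  connB := isPathConnected_flipY h.connB
  connS := isPathConnected_flipY h.connS
  connR := isPathConnected_flipY h.connR
  PA := by rw [mem_preimage, flipY_flipY]; exact h.PA
  QA := by rw [mem_preimage, flipY_flipY]; exact h.QA
  PB := by rw [mem_preimage, flipY_flipY]; exact h.PB
  QB := by rw [mem_preimage, flipY_flipY]; exact h.QB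
  PS := by rw [mem_preimage, flipY_flipY]; exact h.PS
  PS' := by rw [mem_preimage, flipY_flipY]; exact h.PS'
  QR := by rw [mem_preimage, flipY_flipY]; exact h.QR
  QR' := by rw [mem_shift_flipY, flipY_flipY]; exact h.QR'
  AA := fun i j u => h.AA i j (flipY u)
  BB := fun i j u => h.BB i j (flipY u)
  AB := fun i j u => h.AB i j (flipY u)
  SA := fun i j u => h.SA i j (flipY u)
  SB := fun i j u => h.SB i j (flipY u)
  RA := fun i j u => h.RA i j (flipY u)
  RB := fun i j u => h.RB i j (flipY u)
  widthS := fun x hx y hy => h.widthS (flipY x) hx (flipY y) hy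
  widthR := fun x hx y hy => h.widthR (flipY x) hx (flipY y) hy
  stripA := fun u hu => neg_mem_Icc_iff.1 (h.stripA _ hu)
  stripB := fun u hu => neg_mem_Icc_iff.1 (h.stripB _ hu)
  stripS := fun u hu => neg_mem_Icc_iff.1 (h.stripS _ hu)
  stripR := fun u hu => neg_mem_Icc_iff.1 (h.stripR _ hu)

theorem estimates (h : LinkedArcs A B S R P Q P' Q' k d₁ d₂ lo hi) :
    P'.1 - P.1 ≤ d₁ ∧ P.1 - P'.1 ≤ d₁ ∧ Q'.1 + k - Q.1 ≤ d₂ ∧ Q.1 - Q'.1 - k ≤ d₂ ∧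
      0 ≤ d₁ ∧ 0 ≤ d₂ := by
  have h₁ := sub_le_of_mem_shift h.widthR h.QR' (mem_shift_zero.2 h.QR)
  have h₂ := sub_le_of_mem_shift h.widthR (mem_shift_zero.2 h.QR) h.QR'
  push_cast at h₁ h₂
  have h₃ := h.widthS P h.PS P' h.PS'
  have h₄ := h.widthS P' h.PS' P h.PS
  exact ⟨h₄, h₃, by linarith, by linarith, by linarith, by linarith⟩

theorem le_of_top_left_bot_left (h : LinkedArcs A B S R P Q P' Q' k d₁ d₂ lo hi)
    (htop : ∃ z ∈ A, z.2 = hi) (hbot : ∃ b ∈ A, b.2 = lo) :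
    Q.1 - P.1 - (Q'.1 - P'.1) ≤ 2 * d₁ + 2 * d₂ + 2 := by
  obtain ⟨z, hzA, hz⟩ := htop
  obtain ⟨b, hbA, hb⟩ := hbot
  obtain ⟨e₁, e₂, e₃, e₄, e₅, e₆⟩ := h.estimates
  by_contra! hlt
  have hk : 2 ≤ k := by
    have : (1 : ℝ) < k := by linarith
    exact_mod_cast this
  have hkr : (2 : ℝ) ≤ k := by exact_mod_cast hk
  have j₂ : JoinedIn (A ∪ S ∪ B ∪ shift (-k) R ∪ shift (-k) A) z (shiftPoint (-k) b) := by
    refine ((((h.connA.joinedIn z hzA P h.PA).mono ?_).trans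
      ((h.connS.joinedIn P h.PS P' h.PS').mono ?_)).trans
      ((h.connB.joinedIn P' h.PB Q' h.QB).mono ?_)).trans
      ((((isPathConnected_shift h.connR (-k)).joinedIn Q' h.QR' (shiftPoint (-k) Q)
        (shiftPoint_mem_shift.2 h.QR)).mono ?_).trans
      ((joinedIn_shift h.connA h.QA hbA).mono ?_)) <;>
    · intro u hu; simp only [mem_union]; tauto
  obtain ⟨u, hu, hu'⟩ := inter_nonempty_of_crossing (joinedIn_shift (i := -1) h.connA hzA hbA) j₂
    (lo := lo) (hi := hi) (fun u hu => mem_strip_of_mem_shift h.stripA hu)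
    (by
      rintro u ((((hu | hu) | hu) | hu) | hu)
      exacts [h.stripA u hu, h.stripS u hu, h.stripB u hu, mem_strip_of_mem_shift h.stripR hu,
        mem_strip_of_mem_shift h.stripA hu])
    hz hz hb hb (by simp [shiftPoint]) (by simp only [shiftPoint]; push_cast; linarith)
  rcases hu' with (((hu' | hu') | hu') | hu') | hu'
  · have := h.AA _ _ u hu (mem_shift_zero.2 hu'); omega
  · have := h.SA _ _ u (mem_shift_zero.2 hu') hu; omega
  · exact h.AB _ _ u hu (mem_shift_zero.2 hu')
  · have := h.RA _ _ u hu' hu; omega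
  · have := h.AA _ _ u hu hu'; omega

theorem le_of_top_left_bot_right (h : LinkedArcs A B S R P Q P' Q' k d₁ d₂ lo hi)
    (htop : ∃ z ∈ A, z.2 = hi) (hbot : ∃ b ∈ B, b.2 = lo) :
    Q.1 - P.1 - (Q'.1 - P'.1) ≤ 2 * d₁ + 2 * d₂ + 2 := by
  obtain ⟨z, hzA, hz⟩ := htop
  obtain ⟨b, hbB, hb⟩ := hbot
  obtain ⟨e₁, e₂, e₃, e₄, e₅, e₆⟩ := h.estimates
  by_contra! hlt
  have hk : 2 ≤ k := by
    have : (1 : ℝ) < k := by linarith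
    exact_mod_cast this
  have key : ∀ i : ℤ, 0 < i → i < k → ∃ u, u ∈ shift i S ∧ u ∈ R := by
    intro i hi0 hik
    have hi0' : (0 : ℝ) < i := by exact_mod_cast hi0
    have hik' : (i : ℝ) < k := by exact_mod_cast hik
    have hQk : shiftPoint k Q' ∈ R := by
      have := shiftPoint_mem_shift (i := k).2 h.QR'
      rwa [mem_shift_shift, add_neg_cancel, mem_shift_zero] at this
    have j₁ : JoinedIn (A ∪ R ∪ shift k B) z (shiftPoint k b) := by
      refine (((h.connA.joinedIn z hzA Q h.QA).mono ?_).trans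
        ((h.connR.joinedIn Q h.QR _ hQk).mono ?_)).trans
        ((joinedIn_shift h.connB h.QB hbB).mono ?_) <;>
      · intro u hu; simp only [mem_union]; tauto
    have j₂ : JoinedIn (shift i A ∪ shift i S ∪ shift i B) (shiftPoint i z) (shiftPoint i b) := by
      refine (((joinedIn_shift h.connA hzA h.PA).mono ?_).trans
        ((joinedIn_shift h.connS h.PS h.PS').mono ?_)).trans
        ((joinedIn_shift h.connB h.PB hbB).mono ?_) <;>
      · intro u hu; simp only [mem_union]; tauto
    obtain ⟨u, hu, hu'⟩ := inter_nonempty_of_crossing j₁ j₂ (lo := lo) (hi := hi)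
      (by
        rintro u ((hu | hu) | hu)
        exacts [h.stripA u hu, h.stripR u hu, mem_strip_of_mem_shift h.stripB hu])
      (by
        rintro u ((hu | hu) | hu)
        exacts [mem_strip_of_mem_shift h.stripA hu, mem_strip_of_mem_shift h.stripS hu,
          mem_strip_of_mem_shift h.stripB hu])
      hz hz hb hb (by simp [shiftPoint, hi0]) (by simp [shiftPoint, hik])
    rcases hu with (hu | hu) | hu <;> rcases hu' with (hu' | hu') | hu'
    · have := h.AA _ _ u (mem_shift_zero.2 hu) hu'; omega
    · have := h.SA _ _ u hu' (mem_shift_zero.2 hu); omega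
    · exact absurd hu' (h.AB _ _ u (mem_shift_zero.2 hu))
    · have := h.RA _ _ u (mem_shift_zero.2 hu) hu'; omega
    · exact ⟨u, hu', hu⟩
    · have := h.RB _ _ u (mem_shift_zero.2 hu) hu'; omega
    · exact absurd hu (h.AB _ _ u hu')
    · have := h.SB _ _ u hu' hu; omega
    · have := h.BB _ _ u hu hu'; omega
  obtain ⟨u, huS, huR⟩ := key 1 (by omega) (by omega)
  obtain ⟨v, hvS, hvR⟩ := key (k - 1) (by omega) (by omega)
  have w₁ := sub_le_of_mem_shift h.widthS huS hvS
  have w₂ := h.widthR v hvR u huR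
  push_cast at w₁
  linarith

/-- The head of a curve through a translate of `S` lies to the left of `P'`, and conversely, as
soon as the translation is large enough. -/
theorem head_order (h : LinkedArcs A B S R P Q P' Q' k d₁ d₂ lo hi) {i : ℤ}
    (hi' : d₁ - (P'.1 - P.1) < i) :
    (∀ u ∈ shift (-i) S, u.1 < P'.1) ∧ ∀ u ∈ S, (shiftPoint (-i) P).1 < u.1 := by
  refine ⟨fun u hu => ?_, fun u hu => ?_⟩
  · have := sub_le_of_mem_shift h.widthS hu (mem_shift_zero.2 h.PS)
    push_cast at this
    linarith
  · have := h.widthS P' h.PS' u hu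
    simp only [shiftPoint]
    push_cast
    linarith

theorem le_of_top_start_bot_left (h : LinkedArcs A B S R P Q P' Q' k d₁ d₂ lo hi)
    (htop : ∃ z ∈ S, z.2 = hi) (hbot : ∃ b ∈ A, b.2 = lo) :
    Q.1 - P.1 - (Q'.1 - P'.1) ≤ 2 * d₁ + 2 * d₂ + 2 := by
  obtain ⟨z, hzS, hz⟩ := htop
  obtain ⟨b, hbA, hb⟩ := hbot
  obtain ⟨e₁, e₂, e₃, e₄, e₅, e₆⟩ := h.estimates
  by_contra! hlt
  have key : ∀ i : ℤ, d₁ - (P'.1 - P.1) < i → i < k → ∃ u, u ∈ shift (-i) S ∧ u ∈ shift (-k) R := by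
    intro i hi0 hik
    have hipos : 0 < i := by
      have : (0 : ℝ) < i := by linarith
      exact_mod_cast this
    have hik' : (i : ℝ) < k := by exact_mod_cast hik
    have j₂ : JoinedIn (B ∪ shift (-k) R ∪ shift (-k) A) P' (shiftPoint (-k) b) := by
      refine ((h.connB.joinedIn P' h.PB Q' h.QB).mono ?_).trans
        ((((isPathConnected_shift h.connR (-k)).joinedIn Q' h.QR' (shiftPoint (-k) Q)
          (shiftPoint_mem_shift.2 h.QR)).mono ?_).trans
        ((joinedIn_shift h.connA h.QA hbA).mono ?_)) <;>
      · intro u hu; simp only [mem_union]; tauto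
    have ho := h.head_order hi0
    have hbb : (shiftPoint (-k) b).1 < (shiftPoint (-i) b).1 := by
      simp only [shiftPoint]; push_cast; linarith
    obtain ⟨u, hu⟩ := exists_mem_crossing (lo := lo) (hi := hi)
      (joinedIn_shift (i := -i) h.connS hzS h.PS) (joinedIn_shift (i := -i) h.connA h.PA hbA)
      (JoinedIn.refl (mem_singleton _)) (h.connS.joinedIn z hzS P' h.PS') j₂
      (JoinedIn.refl (mem_singleton _))
      (by
        rintro u ((hu | hu) | rfl)
        exacts [mem_strip_of_mem_shift h.stripS hu, mem_strip_of_mem_shift h.stripA hu,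
          h.stripA b hbA])
      (by
        rintro u ((hu | ((hu | hu) | hu)) | rfl)
        exacts [h.stripS u hu, h.stripB u hu, mem_strip_of_mem_shift h.stripR hu,
          mem_strip_of_mem_shift h.stripA hu, h.stripA b hbA])
      hz hz hb hb ho.1 ho.2 (by simpa using hbb) (by simpa using hbb)
    have hG₁ : u ∈ ({shiftPoint (-i) b} : Set (ℝ × ℝ)) → u ∈ shift (-i) A := by
      rintro rfl; exact shiftPoint_mem_shift.2 hbA
    have hG₂ : u ∈ ({shiftPoint (-k) b} : Set (ℝ × ℝ)) → u ∈ shift (-k) A := by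
      rintro rfl; exact shiftPoint_mem_shift.2 hbA
    have hAS : u ∈ shift (-i) A → u ∉ S := fun h₁ h₂ => by
      have := h.SA _ _ u (mem_shift_zero.2 h₂) h₁; omega
    have hAB : u ∈ shift (-i) A → u ∉ B := fun h₁ h₂ => h.AB _ _ u h₁ (mem_shift_zero.2 h₂)
    have hAR : u ∈ shift (-i) A → u ∉ shift (-k) R := fun h₁ h₂ => by
      have := h.RA _ _ u h₂ h₁; omega
    have hAA : u ∈ shift (-i) A → u ∉ shift (-k) A := fun h₁ h₂ => by
      have := h.AA _ _ u h₂ h₁; omega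
    have hSB : u ∈ shift (-i) S → u ∉ B := fun h₁ h₂ => by
      have := h.SB _ _ u h₁ (mem_shift_zero.2 h₂); omega
    have hSA : u ∈ shift (-i) S → u ∉ shift (-k) A := fun h₁ h₂ => by
      have := h.SA _ _ u h₁ h₂; omega
    rcases hu with ⟨hu, hu'⟩ | hu
    · rcases hu' with ((hu' | hu') | hu') | hu'
      exacts [absurd hu' (hSB hu), ⟨u, hu, hu'⟩, absurd hu' (hSA hu), absurd (hG₂ hu') (hSA hu)]
    · exfalso
      have hA : u ∈ shift (-i) A := by
        rcases hu with ⟨hu, -⟩ | ⟨hu, -⟩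
        exacts [hu, hG₁ hu]
      rcases hu with ⟨-, hu' | ((hu' | hu') | hu') | hu'⟩ | ⟨-, hu' | ((hu' | hu') | hu')⟩
      exacts [hAS hA hu', hAB hA hu', hAR hA hu', hAA hA hu', hAA hA (hG₂ hu'), hAS hA hu',
        hAB hA hu', hAR hA hu', hAA hA hu']
  set i : ℤ := ⌊d₁ - (P'.1 - P.1)⌋ + 1 with hi'
  have hi1 : d₁ - (P'.1 - P.1) < i := by rw [hi']; push_cast; exact Int.lt_floor_add_one _
  have hi2 : (i : ℝ) ≤ d₁ - (P'.1 - P.1) + 1 := by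
    rw [hi']; push_cast; linarith [Int.floor_le (d₁ - (P'.1 - P.1))]
  have hik : i < k := by
    have : (i : ℝ) < k := by linarith
    exact_mod_cast this
  have hik' : (i : ℝ) ≤ k - 1 := by exact_mod_cast Int.le_sub_one_of_lt hik
  obtain ⟨u, huS, huR⟩ := key i hi1 hik
  obtain ⟨v, hvS, hvR⟩ := key (k - 1) (by push_cast; linarith) (by omega)
  have w₁ := sub_le_of_mem_shift h.widthS hvS huS
  have w₂ := sub_le_of_mem_shift h.widthR huR hvR
  push_cast at w₁ w₂
  linarith

theorem le_of_top_start_bot_start (h : LinkedArcs A B S R P Q P' Q' k d₁ d₂ lo hi)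
    (htop : ∃ z ∈ S, z.2 = hi) (hbot : ∃ b ∈ S, b.2 = lo) :
    Q.1 - P.1 - (Q'.1 - P'.1) ≤ 2 * d₁ + 2 * d₂ + 2 := by
  obtain ⟨z, hzS, hz⟩ := htop
  obtain ⟨b, hbS, hb⟩ := hbot
  obtain ⟨e₁, e₂, e₃, e₄, e₅, e₆⟩ := h.estimates
  have hA := sub_le_of_curve (h.connS.joinedIn z hzS b hbS) hz hb h.stripS h.widthS h.connA
    h.stripA h.PA h.QA fun i x hx hxA => ⟨P, h.PS, Or.inl (by
      obtain rfl := h.SA _ _ x (mem_shift_zero.2 hx) hxA; simp)⟩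
  have hB := sub_le_of_curve (h.connS.joinedIn z hzS b hbS) hz hb h.stripS h.widthS h.connB
    h.stripB h.QB h.PB fun i x hx hxB => ⟨P', h.PS', Or.inr (by
      obtain rfl := h.SB _ _ x (mem_shift_zero.2 hx) hxB; simp)⟩
  linarith

theorem le_of_top_start_bot_end (h : LinkedArcs A B S R P Q P' Q' k d₁ d₂ lo hi)
    (htop : ∃ z ∈ S, z.2 = hi) (hbot : ∃ b ∈ R, b.2 = lo) :
    Q.1 - P.1 - (Q'.1 - P'.1) ≤ 2 * d₁ + 2 * d₂ + 2 := by
  obtain ⟨z, hzS, hz⟩ := htop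
  obtain ⟨b, hbR, hb⟩ := hbot
  obtain ⟨e₁, e₂, e₃, e₄, e₅, e₆⟩ := h.estimates
  by_cases hm : ∃ i j u, u ∈ shift i S ∧ u ∈ shift j R
  · obtain ⟨i, j, u, huS, huR⟩ := hm
    have hΛ : JoinedIn (shift i S ∪ shift j R) (shiftPoint i z) (shiftPoint j b) :=
      (((isPathConnected_shift h.connS i).joinedIn _ (shiftPoint_mem_shift.2 hzS) u huS).mono
        subset_union_left).trans
      (((isPathConnected_shift h.connR j).joinedIn u huR _ (shiftPoint_mem_shift.2 hbR)).mono
        subset_union_right)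
    have hΛs : ∀ u ∈ shift i S ∪ shift j R, u.2 ∈ Icc lo hi := by
      rintro u (hu | hu)
      exacts [mem_strip_of_mem_shift h.stripS hu, mem_strip_of_mem_shift h.stripR hu]
    have hw : ∀ x ∈ shift i S ∪ shift j R, ∀ y ∈ shift i S ∪ shift j R, x.1 - y.1 ≤ d₁ + d₂ := by
      rintro x (hx | hx) y (hy | hy)
      · linarith [sub_le_of_mem_shift h.widthS hx hy]
      · linarith [sub_le_of_mem_shift h.widthS hx huS, sub_le_of_mem_shift h.widthR huR hy]
      · linarith [sub_le_of_mem_shift h.widthR hx huR, sub_le_of_mem_shift h.widthS huS hy]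
      · linarith [sub_le_of_mem_shift h.widthR hx hy]
    have hA := sub_le_of_curve hΛ hz hb hΛs hw h.connA h.stripA h.PA h.QA (by
      rintro n x (hx | hx) hxA
      · obtain rfl := h.SA _ _ x hx hxA
        exact ⟨_, Or.inl (shiftPoint_mem_shift.2 h.PS), Or.inl rfl⟩
      · obtain rfl := h.RA _ _ x hx hxA
        exact ⟨_, Or.inr (shiftPoint_mem_shift.2 h.QR), Or.inr rfl⟩)
    have hB := sub_le_of_curve hΛ hz hb hΛs hw h.connB h.stripB h.QB h.PB (by
      rintro n x (hx | hx) hxB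
      · obtain rfl := h.SB _ _ x hx hxB
        exact ⟨_, Or.inl (shiftPoint_mem_shift.2 h.PS'), Or.inr rfl⟩
      · obtain rfl := h.RB _ _ x hx hxB
        refine ⟨shiftPoint (j + k) Q', Or.inr ?_, Or.inl rfl⟩
        have := shiftPoint_mem_shift (i := j + k).2 h.QR'
        rwa [mem_shift_shift, add_neg_cancel_right] at this)
    linarith
  · push Not at hm
    by_contra! hlt
    set i : ℤ := ⌊d₁ - (P'.1 - P.1)⌋ + 1 with hi'
    have hi1 : d₁ - (P'.1 - P.1) < i := by rw [hi']; push_cast; exact Int.lt_floor_add_one _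
    have hi2 : (i : ℝ) ≤ d₁ - (P'.1 - P.1) + 1 := by
      rw [hi']; push_cast; linarith [Int.floor_le (d₁ - (P'.1 - P.1))]
    have hipos : 0 < i := by
      have : (0 : ℝ) < i := by linarith
      exact_mod_cast this
    have hik : i < k := by
      have : (i : ℝ) < k := by linarith
      exact_mod_cast this
    have ho := h.head_order hi1
    obtain ⟨u, hu⟩ := exists_mem_crossing (lo := lo) (hi := hi)
      (joinedIn_shift (i := -i) h.connS hzS h.PS) (joinedIn_shift (i := -i) h.connA h.PA h.QA)
      (joinedIn_shift (i := -i) h.connR h.QR hbR) (h.connS.joinedIn z hzS P' h.PS')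
      (h.connB.joinedIn P' h.PB Q' h.QB)
      ((isPathConnected_shift h.connR (-k)).joinedIn Q' h.QR' (shiftPoint (-k) b)
        (shiftPoint_mem_shift.2 hbR))
      (by
        rintro u ((hu | hu) | hu)
        exacts [mem_strip_of_mem_shift h.stripS hu, mem_strip_of_mem_shift h.stripA hu,
          mem_strip_of_mem_shift h.stripR hu])
      (by
        rintro u ((hu | hu) | hu)
        exacts [h.stripS u hu, h.stripB u hu, mem_strip_of_mem_shift h.stripR hu])
      hz hz hb hb ho.1 ho.2
      (fun u hu => by
        have := sub_le_of_mem_shift h.widthR (mem_shift_zero.2 h.QR) hu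
        push_cast at this
        linarith)
      (fun u hu => by
        have := sub_le_of_mem_shift h.widthR hu h.QR'
        simp only [shiftPoint]
        push_cast at this ⊢
        linarith)
    rcases hu with ⟨hu, hu' | hu'⟩ | ⟨hu, hu' | hu' | hu'⟩ | ⟨hu, hu' | hu'⟩
    · have := h.SB _ _ u hu (mem_shift_zero.2 hu'); omega
    · exact hm _ _ u hu hu'
    · have := h.SA _ _ u (mem_shift_zero.2 hu') hu; omega
    · exact h.AB _ _ u hu (mem_shift_zero.2 hu')
    · have := h.RA _ _ u hu' hu; omega
    · exact hm _ _ u (mem_shift_zero.2 hu') hu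
    · have := h.RB _ _ u hu (mem_shift_zero.2 hu'); omega

theorem abs_le_of_le
    (hle : Q.1 - P.1 - (Q'.1 - P'.1) ≤ 2 * d₁ + 2 * d₂ + 2)
    (hle' : (flipX Q).1 - (flipX P).1 - ((flipX Q').1 - (flipX P').1) ≤ 2 * d₁ + 2 * d₂ + 2) :
    |Q.1 - P.1 - (Q'.1 - P'.1)| ≤ 2 * d₁ + 2 * d₂ + 2 := by
  simp only [flipX] at hle'
  exact abs_le.2 ⟨by linarith, hle⟩

theorem abs_le_of_top_start_bot_left (h : LinkedArcs A B S R P Q P' Q' k d₁ d₂ lo hi)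
    (htop : ∃ z ∈ S, z.2 = hi) (hbot : ∃ b ∈ A, b.2 = lo) :
    |Q.1 - P.1 - (Q'.1 - P'.1)| ≤ 2 * d₁ + 2 * d₂ + 2 :=
  abs_le_of_le (h.le_of_top_start_bot_left htop hbot)
    (h.reflectX.le_of_top_start_bot_left (exists_flipX htop) (exists_flipX hbot))

theorem abs_le_of_top_start (h : LinkedArcs A B S R P Q P' Q' k d₁ d₂ lo hi)
    (htop : ∃ z ∈ S, z.2 = hi)
    (hbot : (∃ b ∈ A, b.2 = lo) ∨ (∃ b ∈ B, b.2 = lo) ∨ (∃ b ∈ S, b.2 = lo) ∨ ∃ b ∈ R, b.2 = lo) :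
    |Q.1 - P.1 - (Q'.1 - P'.1)| ≤ 2 * d₁ + 2 * d₂ + 2 := by
  rcases hbot with hbot | hbot | hbot | hbot
  · exact h.abs_le_of_top_start_bot_left htop hbot
  · rw [abs_sub_comm]
    exact h.swap.abs_le_of_top_start_bot_left htop hbot
  · exact abs_le_of_le (h.le_of_top_start_bot_start htop hbot)
      (h.reflectX.le_of_top_start_bot_start (exists_flipX htop) (exists_flipX hbot))
  · exact abs_le_of_le (h.le_of_top_start_bot_end htop hbot)
      (h.reflectX.le_of_top_start_bot_end (exists_flipX htop) (exists_flipX hbot))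

theorem abs_le_of_top_end (h : LinkedArcs A B S R P Q P' Q' k d₁ d₂ lo hi)
    (htop : ∃ z ∈ R, z.2 = hi)
    (hbot : (∃ b ∈ A, b.2 = lo) ∨ (∃ b ∈ B, b.2 = lo) ∨ (∃ b ∈ S, b.2 = lo) ∨ ∃ b ∈ R, b.2 = lo) :
    |Q.1 - P.1 - (Q'.1 - P'.1)| ≤ 2 * d₁ + 2 * d₂ + 2 := by
  have := h.reverse.abs_le_of_top_start htop
    (hbot.imp_right fun hbot => hbot.imp (exists_shift k) Or.symm)
  rw [abs_sub_comm, add_comm (2 * d₁)]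
  convert this using 2
  simp only [shiftPoint]
  ring

theorem abs_le_of_top_left (h : LinkedArcs A B S R P Q P' Q' k d₁ d₂ lo hi)
    (htop : ∃ z ∈ A, z.2 = hi)
    (hbot : (∃ b ∈ A, b.2 = lo) ∨ (∃ b ∈ B, b.2 = lo) ∨ (∃ b ∈ S, b.2 = lo) ∨ ∃ b ∈ R, b.2 = lo) :
    |Q.1 - P.1 - (Q'.1 - P'.1)| ≤ 2 * d₁ + 2 * d₂ + 2 := by
  rcases hbot with hbot | hbot | hbot | hbot
  · exact abs_le_of_le (h.le_of_top_left_bot_left htop hbot)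
      (h.reflectX.le_of_top_left_bot_left (exists_flipX htop) (exists_flipX hbot))
  · exact abs_le_of_le (h.le_of_top_left_bot_right htop hbot)
      (h.reflectX.le_of_top_left_bot_right (exists_flipX htop) (exists_flipX hbot))
  · exact h.reflectY.abs_le_of_top_start (exists_flipY hbot) (Or.inl (exists_flipY htop))
  · exact h.reflectY.abs_le_of_top_end (exists_flipY hbot) (Or.inl (exists_flipY htop))

/-- The winding bound for lifted configurations whose extreme heights are attained. -/
theorem abs_le (h : LinkedArcs A B S R P Q P' Q' k d₁ d₂ lo hi)
    (htop : (∃ z ∈ A, z.2 = hi) ∨ (∃ z ∈ B, z.2 = hi) ∨ (∃ z ∈ S, z.2 = hi) ∨ ∃ z ∈ R, z.2 = hi)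
    (hbot : (∃ b ∈ A, b.2 = lo) ∨ (∃ b ∈ B, b.2 = lo) ∨ (∃ b ∈ S, b.2 = lo) ∨ ∃ b ∈ R, b.2 = lo) :
    |Q.1 - P.1 - (Q'.1 - P'.1)| ≤ 2 * d₁ + 2 * d₂ + 2 := by
  rcases htop with htop | htop | htop | htop
  · exact h.abs_le_of_top_left htop hbot
  · rw [abs_sub_comm]
    refine h.swap.abs_le_of_top_left htop ?_
    rcases hbot with hbot | hbot | hbot | hbot
    exacts [Or.inr (Or.inl hbot), Or.inl hbot, Or.inr (Or.inr (Or.inl hbot)),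
      Or.inr (Or.inr (Or.inr (exists_shift _ hbot)))]
  · exact h.abs_le_of_top_start htop hbot
  · exact h.abs_le_of_top_end htop hbot

end LinkedArcs

theorem τ_shiftPoint (i : ℤ) (u : ℝ × ℝ) : τ (shiftPoint i u) = τ u := by
  ext
  · simp only [τ, shiftPoint]
    rw [AddCircle.coe_add, add_eq_left, AddCircle.coe_eq_zero_iff]
    exact ⟨i, by simp⟩
  · rfl

theorem exists_shiftPoint_eq {u v : ℝ × ℝ} (h : τ u = τ v) : ∃ i : ℤ, shiftPoint i u = v := by
  have h₁ : (u.1 : 𝕊) = (v.1 : 𝕊) := (Prod.ext_iff.1 h).1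
  have h₂ : u.2 = v.2 := (Prod.ext_iff.1 h).2
  have h₀ : ((v.1 - u.1 : ℝ) : 𝕊) = 0 := by rw [AddCircle.coe_sub, h₁, sub_self]
  obtain ⟨i, hi⟩ := (AddCircle.coe_eq_zero_iff (1 : ℝ)).1 h₀
  rw [zsmul_eq_mul, mul_one] at hi
  exact ⟨i, Prod.ext (by simp [shiftPoint, hi]) h₂⟩

theorem exists_mem_of_mem_shift {A : Set (ℝ × ℝ)} {i : ℤ} {u : ℝ × ℝ} (h : u ∈ shift i A) :
    ∃ v ∈ A, shiftPoint i v = u := by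
  rwa [shift_eq_image] at h

/-- A path from `x` to `y` contains a subpath from `x` to `y` meeting `{x, y}` only at its
ends. -/
theorem exists_trim {X : Type*} [TopologicalSpace X] [T1Space X] {σ : ℝ → X} {c d : ℝ}
    (hcd : c ≤ d) (hσ : ContinuousOn σ (Icc c d)) :
    ∃ c₁ d₁, c ≤ c₁ ∧ c₁ ≤ d₁ ∧ d₁ ≤ d ∧ σ c₁ = σ c ∧ σ d₁ = σ d ∧
      (∀ u ∈ Icc c₁ d₁, σ u = σ c → u = c₁) ∧ ∀ u ∈ Icc c₁ d₁, σ u = σ d → u = d₁ := by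
  have hcl : IsCompact (Icc c d ∩ σ ⁻¹' {σ c}) := isCompact_Icc.of_isClosed_subset
    (hσ.preimage_isClosed_of_isClosed isClosed_Icc isClosed_singleton) inter_subset_left
  obtain ⟨c₁, ⟨hc₁, hc₁σ⟩, hc₁max⟩ := hcl.exists_isGreatest ⟨c, ⟨le_rfl, hcd⟩, rfl⟩
  have hsub : Icc c₁ d ⊆ Icc c d := Icc_subset_Icc_left hc₁.1
  have hcl' : IsCompact (Icc c₁ d ∩ σ ⁻¹' {σ d}) := isCompact_Icc.of_isClosed_subset
    ((hσ.mono hsub).preimage_isClosed_of_isClosed isClosed_Icc isClosed_singleton)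
    inter_subset_left
  obtain ⟨d₁, ⟨hd₁, hd₁σ⟩, hd₁min⟩ := hcl'.exists_isLeast ⟨d, ⟨hc₁.2, le_rfl⟩, rfl⟩
  refine ⟨c₁, d₁, hc₁.1, hd₁.1, hd₁.2, hc₁σ, hd₁σ, fun u hu huσ => ?_, fun u hu huσ => ?_⟩
  · exact le_antisymm (hc₁max ⟨⟨hc₁.1.trans hu.1, hu.2.trans hd₁.2⟩, huσ⟩) hu.1
  · exact le_antisymm hu.2 (hd₁min ⟨⟨hu.1, hu.2.trans hd₁.2⟩, huσ⟩)

/-- A connecting arc lifts, after trimming, to a curve starting at any prescribed lift of its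
initial point. -/
theorem exists_connecting_lift {σ : ℝ → 𝔸} {σt : ℝ → ℝ × ℝ} {c d : ℝ} (hcd : c ≤ d)
    (hσ : ContinuousOn σ (Icc c d)) (hlift : IsLiftOn σt σ c d) {P : ℝ × ℝ}
    (hP : τ P = σ c) :
    ∃ (S : Set (ℝ × ℝ)) (E : ℝ × ℝ), IsPathConnected S ∧ IsCompact S ∧ P ∈ S ∧ E ∈ S ∧
      τ E = σ d ∧ (∀ u ∈ S, τ u = σ c → u = P) ∧ (∀ u ∈ S, τ u = σ d → u = E) ∧
      (∀ u ∈ S, τ u ∈ σ '' Icc c d) ∧ ∀ x ∈ S, ∀ y ∈ S, x.1 - y.1 ≤ D σt c d := by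
  obtain ⟨c₁, d₁, hc₁, h₁, hd₁, hσc, hσd, hc, hd⟩ := exists_trim hcd hσ
  have hsub : Icc c₁ d₁ ⊆ Icc c d := Icc_subset_Icc hc₁ hd₁
  have mc : c₁ ∈ Icc c₁ d₁ := ⟨le_rfl, h₁⟩
  have md : d₁ ∈ Icc c₁ d₁ := ⟨h₁, le_rfl⟩
  obtain ⟨n, hn⟩ := exists_shiftPoint_eq (u := σt c₁) (v := P)
    (by rw [hlift.2 _ (hsub mc), hσc, hP])
  have hτ : ∀ u ∈ Icc c₁ d₁, τ (shiftPoint n (σt u)) = σ u := fun u hu => by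
    rw [τ_shiftPoint, hlift.2 _ (hsub hu)]
  have hcont : ContinuousOn (fun u => shiftPoint n (σt u)) (Icc c₁ d₁) :=
    (continuous_shiftPoint n).comp_continuousOn (hlift.1.mono hsub)
  refine ⟨(fun u => shiftPoint n (σt u)) '' Icc c₁ d₁, shiftPoint n (σt d₁), ?_, ?_, ?_, ?_, ?_,
    ?_, ?_, ?_, ?_⟩
  · exact ((convex_Icc c₁ d₁).isPathConnected ⟨c₁, mc⟩).image' hcont
  · exact isCompact_Icc.image_of_continuousOn hcont
  · exact ⟨c₁, mc, hn⟩
  · exact ⟨d₁, md, rfl⟩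
  · rw [hτ d₁ md, hσd]
  · rintro _ ⟨u, hu, rfl⟩ h
    simp only [hτ u hu] at h
    simp only [hc u hu h, hn]
  · rintro _ ⟨u, hu, rfl⟩ h
    simp only [hτ u hu] at h
    simp only [hd u hu h]
  · rintro _ ⟨u, hu, rfl⟩
    exact ⟨u, hsub hu, (hτ u hu).symm⟩
  · rintro _ ⟨u, hu, rfl⟩ _ ⟨v, hv, rfl⟩
    have hb : Bornology.IsBounded (Prod.fst '' (σt '' Icc c d)) :=
      ((isCompact_Icc.image_of_continuousOn hlift.1).image continuous_fst).isBounded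
    have := dist_le_diam_of_mem hb (mem_image_of_mem _ (mem_image_of_mem _ (hsub hu)))
      (mem_image_of_mem _ (mem_image_of_mem _ (hsub hv)))
    rw [Real.dist_eq] at this
    simp only [shiftPoint, add_sub_add_right_eq_sub]
    exact (le_abs_self _).trans this

/-- A simple arc lifts to a curve starting at any prescribed lift of its initial point. -/
theorem exists_simple_lift {α : ℝ → 𝔸} {αt : ℝ → ℝ × ℝ} {a b : ℝ} (hab : a ≤ b)
    (hinj : InjOn α (Icc a b)) (hlift : IsLiftOn αt α a b) {P : ℝ × ℝ} (hP : τ P = α a) :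
    ∃ (A : Set (ℝ × ℝ)) (Q : ℝ × ℝ), IsPathConnected A ∧ IsCompact A ∧ P ∈ A ∧ Q ∈ A ∧
      τ Q = α b ∧ Q.1 - P.1 = W αt a b ∧ InjOn τ A ∧ ∀ u ∈ A, τ u ∈ α '' Icc a b := by
  have ma : a ∈ Icc a b := ⟨le_rfl, hab⟩
  have mb : b ∈ Icc a b := ⟨hab, le_rfl⟩
  obtain ⟨n, rfl⟩ := exists_shiftPoint_eq (u := αt a) (v := P) (by rw [hlift.2 _ ma, hP])
  have hτ : ∀ u ∈ Icc a b, τ (shiftPoint n (αt u)) = α u := fun u hu => by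
    rw [τ_shiftPoint, hlift.2 _ hu]
  have hcont : ContinuousOn (fun u => shiftPoint n (αt u)) (Icc a b) :=
    (continuous_shiftPoint n).comp_continuousOn hlift.1
  refine ⟨(fun u => shiftPoint n (αt u)) '' Icc a b, shiftPoint n (αt b),
    ((convex_Icc a b).isPathConnected ⟨a, ma⟩).image' hcont,
    isCompact_Icc.image_of_continuousOn hcont, ⟨a, ma, rfl⟩, ⟨b, mb, rfl⟩, hτ b mb, ?_, ?_, ?_⟩
  · simp [shiftPoint, W]
  · rintro _ ⟨u, hu, rfl⟩ _ ⟨v, hv, rfl⟩ h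
    simp only [hτ u hu, hτ v hv] at h
    simp only [hinj hu hv h]
  · rintro _ ⟨u, hu, rfl⟩
    exact ⟨u, hu, (hτ u hu).symm⟩

/-- A lifted connecting arc from `x` to `y` meets the translates of a lifted simple arc through
`x`, disjoint from `y`, only at the translates of the lift of `x`. -/
theorem eq_of_mem_shift_connecting {S A : Set (ℝ × ℝ)} {x y : 𝔸} {𝒜 𝒮 : Set 𝔸}
    {E P : ℝ × ℝ} (hS : ∀ u ∈ S, τ u ∈ 𝒮) (hA : ∀ u ∈ A, τ u ∈ 𝒜) (hinj : InjOn τ A)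
    (hinter : 𝒮 ∩ 𝒜 ⊆ {x, y}) (hy : y ∉ 𝒜) (hE : ∀ u ∈ S, τ u = x → u = E) (hP : P ∈ A)
    (hPx : τ P = x) {i j : ℤ} {u : ℝ × ℝ} (hu : u ∈ shift i S) (hu' : u ∈ shift j A) :
    shiftPoint i E = shiftPoint j P := by
  obtain ⟨s, hs, hsu⟩ := exists_mem_of_mem_shift hu
  obtain ⟨a, ha, hau⟩ := exists_mem_of_mem_shift hu'
  have hsa : τ s = τ a := by rw [← τ_shiftPoint i s, hsu, ← hau, τ_shiftPoint]
  have hmem : τ a ∈ 𝒜 := hA a ha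
  have hx : τ a = x := (hinter ⟨hsa ▸ hS s hs, hmem⟩).resolve_right fun h => hy (h ▸ hmem)
  rw [← hE s hs (hsa.trans hx), ← hinj ha hP (hx.trans hPx.symm), hsu, hau]

theorem eq_of_shiftPoint_eq {i j : ℤ} {u : ℝ × ℝ} (h : shiftPoint i u = shiftPoint j u) :
    i = j := by
  have := congrArg Prod.fst h
  simpa [shiftPoint] using this

theorem eq_of_mem_shift_of_injOn {A : Set (ℝ × ℝ)} (hinj : InjOn τ A) {i j : ℤ} {u : ℝ × ℝ}
    (hu : u ∈ shift i A) (hu' : u ∈ shift j A) : i = j := by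
  obtain ⟨s, hs, hsu⟩ := exists_mem_of_mem_shift hu
  obtain ⟨a, ha, hau⟩ := exists_mem_of_mem_shift hu'
  have hsa : τ s = τ a := by rw [← τ_shiftPoint i s, hsu, ← hau, τ_shiftPoint]
  obtain rfl := hinj hs ha hsa
  exact eq_of_shiftPoint_eq (hsu.trans hau.symm)

theorem winding_difference_bound
    -- two disjoint simple arcs `α : [a,b] → 𝔸` and `β : [a',b'] → 𝔸`:
    (a b : ℝ) (hab : a ≤ b)
    (α : ℝ → 𝔸) (hαc : ContinuousOn α (Set.Icc a b)) (hαinj : Set.InjOn α (Set.Icc a b))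
    (a' b' : ℝ) (hab' : a' ≤ b')
    (β : ℝ → 𝔸) (hβc : ContinuousOn β (Set.Icc a' b')) (hβinj : Set.InjOn β (Set.Icc a' b'))
    (hdisj : Disjoint (α '' Set.Icc a b) (β '' Set.Icc a' b'))
    -- `σ₁ : [c,d] → 𝔸` joins the initial points and is otherwise disjoint from `α`, `β`:
    (c d : ℝ) (hcd : c ≤ d)
    (σ₁ : ℝ → 𝔸) (hσ₁c : ContinuousOn σ₁ (Set.Icc c d))
    (hσ₁i : σ₁ c = α a) (hσ₁f : σ₁ d = β a')
    (hσ₁disj : σ₁ '' Set.Icc c d ∩ (α '' Set.Icc a b ∪ β '' Set.Icc a' b') ⊆ {α a, β a'})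
    -- `σ₂ : [c',d'] → 𝔸` joins the final points and is otherwise disjoint from `α`, `β`:
    (c' d' : ℝ) (hcd' : c' ≤ d')
    (σ₂ : ℝ → 𝔸) (hσ₂c : ContinuousOn σ₂ (Set.Icc c' d'))
    (hσ₂i : σ₂ c' = α b) (hσ₂f : σ₂ d' = β b')
    (hσ₂disj : σ₂ '' Set.Icc c' d' ∩ (α '' Set.Icc a b ∪ β '' Set.Icc a' b') ⊆ {α b, β b'})
    -- lifts:
    (αt : ℝ → ℝ × ℝ) (hαt : IsLiftOn αt α a b)
    (βt : ℝ → ℝ × ℝ) (hβt : IsLiftOn βt β a' b')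
    (σ₁t : ℝ → ℝ × ℝ) (hσ₁t : IsLiftOn σ₁t σ₁ c d)
    (σ₂t : ℝ → ℝ × ℝ) (hσ₂t : IsLiftOn σ₂t σ₂ c' d') :
    |W αt a b - W βt a' b'| ≤ 2 * D σ₁t c d + 2 * D σ₂t c' d' + 2 := by
  have ma : a ∈ Icc a b := ⟨le_rfl, hab⟩
  have mb : b ∈ Icc a b := ⟨hab, le_rfl⟩
  have ma' : a' ∈ Icc a' b' := ⟨le_rfl, hab'⟩
  have mb' : b' ∈ Icc a' b' := ⟨hab', le_rfl⟩
  have hβα : ∀ t ∈ Icc a' b', β t ∉ α '' Icc a b := fun t ht h =>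
    disjoint_left.1 hdisj h ⟨t, ht, rfl⟩
  have hαβ : ∀ t ∈ Icc a b, α t ∉ β '' Icc a' b' := fun t ht h =>
    disjoint_left.1 hdisj ⟨t, ht, rfl⟩ h
  obtain ⟨A, Q, cA, kA, PA, QA, hQ, hWA, iA, sA⟩ :=
    exists_simple_lift hab hαinj hαt (hαt.2 a ma)
  set P := αt a
  have hP : τ P = α a := hαt.2 a ma
  obtain ⟨S, P', cS, kS, PS, PS', hP', eS, eS', sS, wS⟩ :=
    exists_connecting_lift hcd hσ₁c hσ₁t (hP.trans hσ₁i.symm)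
  rw [hσ₁f] at hP' eS'
  rw [hσ₁i] at eS
  obtain ⟨B, Q', cB, kB, PB, QB, hQ', hWB, iB, sB⟩ := exists_simple_lift hab' hβinj hβt hP'
  obtain ⟨R, E, cR, kR, QR, ER, hE, eR, eR', sR, wR⟩ :=
    exists_connecting_lift hcd' hσ₂c hσ₂t (hQ.trans hσ₂i.symm)
  rw [hσ₂f] at hE eR'
  rw [hσ₂i] at eR
  obtain ⟨k, rfl⟩ := exists_shiftPoint_eq (hQ'.trans hE.symm)
  have kU : IsCompact (A ∪ B ∪ S ∪ R) := ((kA.union kB).union kS).union kR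
  have nU : (A ∪ B ∪ S ∪ R).Nonempty := ⟨P, Or.inl (Or.inl (Or.inl PA))⟩
  obtain ⟨z, hz, hzmax⟩ := kU.exists_isMaxOn nU continuous_snd.continuousOn
  obtain ⟨m, hm, hmmin⟩ := kU.exists_isMinOn nU continuous_snd.continuousOn
  have hstrip : ∀ u ∈ A ∪ B ∪ S ∪ R, u.2 ∈ Icc m.2 z.2 := fun u hu => ⟨hmmin hu, hzmax hu⟩
  have hloc : ∀ v ∈ A ∪ B ∪ S ∪ R, (∃ w ∈ A, w.2 = v.2) ∨ (∃ w ∈ B, w.2 = v.2) ∨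
      (∃ w ∈ S, w.2 = v.2) ∨ ∃ w ∈ R, w.2 = v.2 := by
    rintro v (((hv | hv) | hv) | hv)
    exacts [Or.inl ⟨v, hv, rfl⟩, Or.inr (Or.inl ⟨v, hv, rfl⟩),
      Or.inr (Or.inr (Or.inl ⟨v, hv, rfl⟩)), Or.inr (Or.inr (Or.inr ⟨v, hv, rfl⟩))]
  rw [inter_union_distrib_left, union_subset_iff] at hσ₁disj hσ₂disj
  have hconf : LinkedArcs A B S R P Q P' Q' k (D σ₁t c d) (D σ₂t c' d') m.2 z.2 :=
    { connA := cA
      connB := cB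
      connS := cS
      connR := cR
      PA := PA
      QA := QA
      PB := PB
      QB := QB
      PS := PS
      PS' := PS'
      QR := QR
      QR' := by simpa [mem_shift_iff, shiftPoint] using ER
      AA := fun i j u => eq_of_mem_shift_of_injOn iA
      BB := fun i j u => eq_of_mem_shift_of_injOn iB
      AB := fun i j u hu hu' => by
        obtain ⟨s, hs, rfl⟩ := exists_mem_of_mem_shift hu
        obtain ⟨v, hv, hvs⟩ := exists_mem_of_mem_shift hu'
        refine disjoint_left.1 hdisj (sA s hs) ?_
        rw [← τ_shiftPoint i s, ← hvs, τ_shiftPoint]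
        exact sB v hv
      SA := fun i j u hu hu' => eq_of_shiftPoint_eq (eq_of_mem_shift_connecting sS sA iA
        hσ₁disj.1 (hβα a' ma') eS PA hP hu hu')
      SB := fun i j u hu hu' => eq_of_shiftPoint_eq (eq_of_mem_shift_connecting sS sB iB
        (hσ₁disj.2.trans_eq (pair_comm _ _)) (hαβ a ma) eS' PB hP' hu hu')
      RA := fun i j u hu hu' => eq_of_shiftPoint_eq (eq_of_mem_shift_connecting sR sA iA
        hσ₂disj.1 (hβα b' mb') eR QA hQ hu hu')
      RB := fun i j u hu hu' => by
        refine eq_of_shiftPoint_eq (u := Q') ?_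
        rw [← eq_of_mem_shift_connecting sR sB iB
          (hσ₂disj.2.trans_eq (pair_comm _ _)) (hαβ b mb) eR' QB hQ' hu hu']
        simp only [shiftPoint, Int.cast_add]
        rw [add_assoc, add_comm (i : ℝ)]
      widthS := wS
      widthR := wR
      stripA := fun u hu => hstrip u (Or.inl (Or.inl (Or.inl hu)))
      stripB := fun u hu => hstrip u (Or.inl (Or.inl (Or.inr hu)))
      stripS := fun u hu => hstrip u (Or.inl (Or.inr hu))
      stripR := fun u hu => hstrip u (Or.inr hu) }
  rw [← hWA, ← hWB]
  exact hconf.abs_le (hloc z hz) (hloc m hm)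
end
end

section
/- (Dragging lemma) Let f̂ : 𝔸 → 𝔸 be a homeomorphism isotopic to the identity and let γ ⊂ 𝔸 be a simple loop. Given points x, y ∈ 𝔸, let σ_x, σ_y be simple arcs joining x, y respectively to γ, disjoint from γ except at their endpoints x₀, y₀ ∈ γ; and let σ_{f(x)}, σ_{f(y)} be simple arcs joining f̂(x), f̂(y) respectively to f̂(γ), disjoint from f̂(γ) except at their endpoints x₁, y₁ ∈ f̂(γ). Let I be a simple arc contained in γ joining x₀ to y₀, and I′ a simple arc contained in f̂(γ) joining x₁ to y₁. Then |W(I′) − W(f̂∘I)| ≤ 3 + D(σ_{f(x)}) + D(f̂∘σ_x) + D(σ_{f(y)}) + D(f̂∘σ_y). -/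
/- STATEMENT 13 (Dragging lemma): Let `f̂` be a homeomorphism of the annulus
isotopic to the identity and `γ` a simple loop.  Given simple arcs `σ_x, σ_y`
joining points `x, y` to `γ` (touching `γ` only at their endpoints `x₀, y₀`),
simple arcs `σ_{f(x)}, σ_{f(y)}` joining `f̂(x), f̂(y)` to `f̂(γ)` (touching
`f̂(γ)` only at their endpoints `x₁, y₁`), a simple arc `I ⊆ γ` from `x₀` to
`y₀` and a simple arc `I′ ⊆ f̂(γ)` from `x₁` to `y₁`, one has
`|W(I′) − W(f̂∘I)| ≤ 3 + D(σ_{f(x)}) + D(f̂∘σ_x) + D(σ_{f(y)}) + D(f̂∘σ_y)`.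
Windings and homotopical diameters are computed through arbitrary continuous
lifts. -/

noncomputable section
open Set Metric Filter Topology Function

/-- A continuous angle starting at `0` whose sine stays nonnegative cannot become negative. -/
theorem nonneg_of_sin_nonneg {θ : ℝ → ℝ} (hθ : ContinuousOn θ (Icc 0 1)) (h0 : θ 0 = 0)
    (hsin : ∀ r ∈ Icc (0 : ℝ) 1, 0 ≤ Real.sin (θ r)) : 0 ≤ θ 1 := by
  by_contra! hneg
  have hv : max (θ 1) (-(Real.pi / 2)) ∈ Icc (θ 1) (θ 0) :=
    ⟨le_max_left _ _, by rw [h0]; exact max_le hneg.le (by linarith [Real.pi_pos])⟩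
  obtain ⟨r, hr, hrv⟩ := intermediate_value_Icc' zero_le_one hθ hv
  have hsr := hsin r hr
  rw [hrv] at hsr
  have : Real.sin (max (θ 1) (-(Real.pi / 2))) < 0 :=
    Real.sin_neg_of_neg_of_neg_pi_lt (max_lt hneg (by linarith [Real.pi_pos]))
      (lt_of_lt_of_le (by linarith [Real.pi_pos]) (le_max_right _ _))
  linarith

theorem nonpos_of_sin_nonpos {θ : ℝ → ℝ} (hθ : ContinuousOn θ (Icc 0 1)) (h0 : θ 0 = 0)
    (hsin : ∀ r ∈ Icc (0 : ℝ) 1, Real.sin (θ r) ≤ 0) : θ 1 ≤ 0 := by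
  have := nonneg_of_sin_nonneg (θ := fun r => -θ r) hθ.neg (by simp [h0])
    (fun r hr => by simpa using hsin r hr)
  linarith

/-- A nowhere vanishing continuous function on the plane has a continuous logarithm. -/
theorem exists_continuous_log {F : ℝ × ℝ → ℂ} (hF : Continuous F) (hne : ∀ p, F p ≠ 0)
    (p₀ : ℝ × ℝ) (h₀ : F p₀ = 1) :
    ∃ L : ℝ × ℝ → ℂ, Continuous L ∧ L p₀ = 0 ∧ ∀ p, Complex.exp (L p) = F p := by
  obtain ⟨L, ⟨hL0, hL⟩, -⟩ := Complex.isCoveringMap_exp.existsUnique_continuousMap_lifts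
    (⟨fun p => ⟨F p, hne p⟩, by fun_prop⟩ : C(ℝ × ℝ, {z : ℂ // z ≠ 0})) p₀ 0
    (by simp [h₀])
  exact ⟨L, L.continuous, hL0, fun p => congrArg Subtype.val (congrFun hL p)⟩

theorem τ_eq_iff {p q : ℝ × ℝ} : τ p = τ q ↔ ∃ n : ℤ, q = p + ((n : ℝ), 0) := by
  have h : (p.1 : 𝕊) = q.1 ↔ ∃ n : ℤ, q.1 = p.1 + n := by
    rw [eq_comm, ← sub_eq_zero, ← AddCircle.coe_sub, AddCircle.coe_eq_zero_iff]
    simp only [zsmul_eq_mul, mul_one, sub_eq_iff_eq_add', eq_comm (b := q.1 - p.1)]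
  simp only [τ, h, Prod.ext_iff, Prod.fst_add, Prod.snd_add, add_zero,
    exists_and_right, eq_comm (a := p.2)]

theorem τ_add_int (p : ℝ × ℝ) (n : ℤ) : τ (p + ((n : ℝ), 0)) = τ p :=
  (τ_eq_iff.2 ⟨n, rfl⟩).symm

theorem add_int_of_add_one {Λ : ℝ → ℝ × ℝ} {k : ℤ}
    (hper : ∀ t, Λ (t + 1) = Λ t + ((k : ℝ), 0)) (m : ℤ) :
    ∀ t, Λ (t + m) = Λ t + ((m * k : ℝ), 0) := by
  induction m using Int.induction_on with
  | zero => intro t; simp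
  | succ i ih =>
    intro t
    push_cast at ih ⊢
    rw [← add_assoc, hper, ih]
    ext
    · simp; ring
    · simp
  | pred i ih =>
    intro t
    have h1 := hper (t + ((-(i : ℤ) - 1 : ℤ) : ℝ))
    have h2 := ih t
    push_cast at h1 h2 ⊢
    rw [show t + (-(i : ℝ) - 1) + 1 = t + -(i : ℝ) by ring, h2] at h1
    have h3 := congrArg Prod.fst h1
    have h4 := congrArg Prod.snd h1
    simp only [Prod.fst_add, Prod.snd_add] at h3 h4
    ext
    · simp only [Prod.fst_add]; linarith
    · simp only [Prod.snd_add]; linarith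

/-- The key step: compare a simple curve with its translate by `(1, 0)`, starting from a highest
point, through a logarithm of their difference. -/
theorem not_two_le_of_simple_periodic {Λ : ℝ → ℝ × ℝ} (hΛ : Continuous Λ) {k : ℤ}
    (hper : ∀ t, Λ (t + 1) = Λ t + ((k : ℝ), 0))
    (hinj : ∀ t t', τ (Λ t) = τ (Λ t') → ∃ m : ℤ, t' = t + m) : ¬ 2 ≤ k := by
  intro hk
  have hk' : (2 : ℝ) ≤ k := by exact_mod_cast hk
  have hy : Continuous fun t => (Λ t).2 := by fun_prop
  have hyper : Function.Periodic (fun t => (Λ t).2) 1 := fun t => by simp [hper]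
  obtain ⟨th, hth⟩ : ∃ th, ∀ t, (Λ t).2 ≤ (Λ th).2 := by
    obtain ⟨th, -, hmax⟩ := isCompact_Icc.exists_isMaxOn (nonempty_Icc.2 zero_le_one)
      (hy.continuousOn (s := Icc (0 : ℝ) 1))
    refine ⟨th, fun t => ?_⟩
    obtain ⟨t', ht', he⟩ := hyper.exists_mem_Ico₀ one_pos t
    rw [show (Λ t).2 = (Λ t').2 from he]
    exact hmax ⟨ht'.1, ht'.2.le⟩
  set F : ℝ × ℝ → ℂ := fun p =>
    ⟨(Λ p.2).1 + 1 - (Λ p.1).1, (Λ p.2).2 - (Λ p.1).2⟩ with hF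
  have hFc : Continuous F := by
    have : F = fun p => (((Λ p.2).1 + 1 - (Λ p.1).1 : ℝ) : ℂ)
        + (((Λ p.2).2 - (Λ p.1).2 : ℝ) : ℂ) * Complex.I := by
      funext p; apply Complex.ext <;> simp [hF]
    rw [this]; fun_prop
  have hFne : ∀ p, F p ≠ 0 := by
    rintro ⟨t, t'⟩ h0
    have h1 := congrArg Complex.re h0
    have h2 := congrArg Complex.im h0
    simp only [hF, Complex.zero_re, Complex.zero_im] at h1 h2
    have he : Λ t = Λ t' + (((1 : ℤ) : ℝ), 0) := by ext <;> simp <;> linarith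
    obtain ⟨m, rfl⟩ := hinj t' t (by rw [he, τ_add_int])
    rw [add_int_of_add_one hper] at he
    have h3 := congrArg Prod.fst he
    simp only [Prod.fst_add, add_right_inj] at h3
    norm_cast at h3
    have := Int.isUnit_iff.1 (IsUnit.of_mul_eq_one _ (by rw [mul_comm]; exact h3) : IsUnit k)
    omega
  obtain ⟨L, hLc, hL0, hL⟩ := exists_continuous_log hFc hFne (th, th)
    (by apply Complex.ext <;> simp [hF])
  have him : ∀ p, (F p).im = Real.exp (L p).re * Real.sin (L p).im := fun p => by
    rw [← hL, Complex.exp_im]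
  have hA : (L (th, th - 1)).im ≤ 0 := by
    have := nonpos_of_sin_nonpos (θ := fun r => (L (th, th - r)).im)
      (by fun_prop) (by simp [hL0]) (fun r _ => by
        have h1 := him (th, th - r)
        have h2 : (F (th, th - r)).im ≤ 0 := by simp only [hF]; linarith [hth (th - r)]
        rw [h1] at h2
        exact nonpos_of_mul_nonpos_right h2 (Real.exp_pos _))
    simpa using this
  have hB : 0 ≤ (L (th + 1, th)).im := by
    have := nonneg_of_sin_nonneg (θ := fun r => (L (th + r, th)).im)
      (by fun_prop) (by simp [hL0]) (fun r _ => by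
        have h1 := him (th + r, th)
        have h2 : 0 ≤ (F (th + r, th)).im := by simp only [hF]; linarith [hth (th + r)]
        rw [h1] at h2
        exact nonneg_of_mul_nonneg_right h2 (Real.exp_pos _))
    simpa using this
  obtain ⟨r, -, hr⟩ := intermediate_value_Icc (zero_le_one (α := ℝ))
    (f := fun r => (L (th + r, th - 1 + r)).im) (by fun_prop)
    (show (0 : ℝ) ∈ Icc _ _ by simpa using ⟨hA, hB⟩)
  have hre : (F (th + r, th - 1 + r)).re = 1 - k := by
    have := hper (th - 1 + r)
    rw [show th - 1 + r + 1 = th + r by ring] at this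
    simp only [hF, this, Prod.fst_add]; ring
  rw [← hL, Complex.exp_re] at hre
  simp only at hr
  rw [hr, Real.cos_zero, mul_one] at hre
  linarith [Real.exp_pos (L (th + r, th - 1 + r)).re]

theorem abs_le_one_of_simple_periodic {Λ : ℝ → ℝ × ℝ} (hΛ : Continuous Λ) {k : ℤ}
    (hper : ∀ t, Λ (t + 1) = Λ t + ((k : ℝ), 0))
    (hinj : ∀ t t', τ (Λ t) = τ (Λ t') → ∃ m : ℤ, t' = t + m) : |k| ≤ 1 := by
  have h1 := not_two_le_of_simple_periodic hΛ hper hinj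
  have h2 := not_two_le_of_simple_periodic (Λ := fun t => Λ (-t)) (k := -k) (by fun_prop)
    (fun t => by
      have := hper (-(t + 1))
      rw [show -(t + 1) + 1 = -t by ring] at this
      rw [this]; ext <;> simp)
    (fun t t' h => by
      obtain ⟨m, hm⟩ := hinj _ _ h
      exact ⟨-m, by push_cast; linarith⟩)
  rw [abs_le]; omega

/-- The extension of `P : [0,1] → ℝ²` to the line which commutes with integer translations up to
multiples of `(K, 0)`. -/
def periodicExt (P : ℝ → ℝ × ℝ) (K : ℤ) (t : ℝ) : ℝ × ℝ :=
  P (Int.fract t) + (((⌊t⌋ * K : ℤ) : ℝ), 0)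

theorem τ_periodicExt (P : ℝ → ℝ × ℝ) (K : ℤ) (t : ℝ) :
    τ (periodicExt P K t) = τ (P (Int.fract t)) :=
  τ_add_int _ _

theorem periodicExt_add_one (P : ℝ → ℝ × ℝ) (K : ℤ) (t : ℝ) :
    periodicExt P K (t + 1) = periodicExt P K t + ((K : ℝ), 0) := by
  ext
  · simp [periodicExt]; ring
  · simp [periodicExt]

theorem continuous_periodicExt {P : ℝ → ℝ × ℝ} {K : ℤ} (hP : ContinuousOn P (Icc 0 1))
    (h01 : P 1 = P 0 + ((K : ℝ), 0)) : Continuous (periodicExt P K) := by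
  have h : Continuous ((fun s => P s - ((s * K : ℝ), (0 : ℝ))) ∘ Int.fract) :=
    ContinuousOn.comp_fract'' (by fun_prop) (by simp [h01])
  have h' : periodicExt P K = fun t =>
      ((fun s => P s - ((s * K : ℝ), (0 : ℝ))) ∘ Int.fract) t + ((t * K : ℝ), 0) := by
    funext t
    have := Int.floor_add_fract t
    ext
    · simp only [periodicExt, Prod.fst_add, comp_apply, Prod.fst_sub]
      push_cast
      linear_combination (K : ℝ) * this
    · simp [periodicExt]
  rw [h']
  exact h.add (by fun_prop)

theorem exists_int_of_τ_periodicExt_eq {P : ℝ → ℝ × ℝ} {K : ℤ}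
    (hinj : InjOn (τ ∘ P) (Ico 0 1)) (t t' : ℝ)
    (h : τ (periodicExt P K t) = τ (periodicExt P K t')) : ∃ m : ℤ, t' = t + m := by
  rw [τ_periodicExt, τ_periodicExt] at h
  have := hinj ⟨Int.fract_nonneg t, Int.fract_lt_one t⟩
    ⟨Int.fract_nonneg t', Int.fract_lt_one t'⟩ h
  obtain ⟨m, hm⟩ := Int.fract_eq_fract.1 this.symm
  exact ⟨m, by linarith⟩

/-- A closed curve which is simple in the annulus winds at most once around it. -/
theorem abs_le_one_of_injOn_Ico {P : ℝ → ℝ × ℝ} {K : ℤ} (hP : ContinuousOn P (Icc 0 1))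
    (h01 : P 1 = P 0 + ((K : ℝ), 0)) (hinj : InjOn (τ ∘ P) (Ico 0 1)) : |K| ≤ 1 :=
  abs_le_one_of_simple_periodic (continuous_periodicExt hP h01) (periodicExt_add_one P K)
    (exists_int_of_τ_periodicExt_eq hinj)

/-- Concatenation of two arcs parametrized by `[0,1]`. -/
def concat (P Q : ℝ → ℝ × ℝ) (t : ℝ) : ℝ × ℝ :=
  if t ≤ 1 / 2 then P (2 * t) else Q (2 * t - 1)

theorem concat_zero (P Q : ℝ → ℝ × ℝ) : concat P Q 0 = P 0 := by simp [concat]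

theorem concat_one (P Q : ℝ → ℝ × ℝ) : concat P Q 1 = Q 1 := by norm_num [concat]

theorem continuousOn_concat {P Q : ℝ → ℝ × ℝ} (hP : ContinuousOn P (Icc 0 1))
    (hQ : ContinuousOn Q (Icc 0 1)) (hPQ : P 1 = Q 0) : ContinuousOn (concat P Q) (Icc 0 1) := by
  have h1 : ContinuousOn (fun t : ℝ => P (2 * t)) (Icc 0 (1 / 2)) :=
    hP.comp (by fun_prop) fun t ht => ⟨by linarith [ht.1], by linarith [ht.2]⟩
  have h2 : ContinuousOn (fun t : ℝ => Q (2 * t - 1)) (Icc (1 / 2) 1) :=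
    hQ.comp (by fun_prop) fun t ht => ⟨by linarith [ht.1], by linarith [ht.2]⟩
  rw [← Icc_union_Icc_eq_Icc (show (0 : ℝ) ≤ 1 / 2 by norm_num) (by norm_num)]
  refine ContinuousOn.union_of_isClosed (h1.congr fun t ht => ?_) (h2.congr fun t ht => ?_)
    isClosed_Icc isClosed_Icc
  · simp [concat, show t ≤ 2⁻¹ by linarith [ht.2]]
  · rcases ht.1.eq_or_lt with rfl | h
    · norm_num [concat, hPQ]
    · simp [concat, show ¬ t ≤ 2⁻¹ by linarith]

theorem injOn_concat {P Q : ℝ → ℝ × ℝ} {S : Set ℝ} (hS : S ⊆ Icc 0 1)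
    (hP : InjOn (τ ∘ P) (Icc 0 1)) (hQ : InjOn (τ ∘ Q) (Icc 0 1))
    (h : ∀ t ∈ Icc (0 : ℝ) 1, ∀ t' ∈ Icc (0 : ℝ) 1, τ (P t) = τ (Q t') →
      t' = 0 ∨ (t = 0 ∧ t' = 1 ∧ (1 : ℝ) ∉ S)) : InjOn (τ ∘ concat P Q) S := by
  have key : ∀ t ∈ S, ∀ t' ∈ S, t ≤ 1 / 2 → 1 / 2 < t' → τ (P (2 * t)) ≠ τ (Q (2 * t' - 1)) := by
    intro t ht t' ht' h1 h2 he
    rcases h _ ⟨by linarith [(hS ht).1], by linarith⟩ _ ⟨by linarith, by linarith [(hS ht').2]⟩ he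
      with h3 | ⟨h3, h4, h5⟩
    · linarith
    · exact h5 (by convert ht'; linarith)
  intro t ht t' ht' he
  have h0 := hS ht
  have h0' := hS ht'
  simp only [comp_apply, concat] at he
  split_ifs at he with h1 h2 h2
  · have := hP ⟨by linarith [h0.1], by linarith⟩ ⟨by linarith [h0'.1], by linarith⟩ he
    linarith
  · exact absurd he (key t ht t' ht' h1 (not_le.1 h2))
  · exact absurd he.symm (key t' ht' t ht h2 (not_le.1 h1))
  · have := hQ ⟨by linarith, by linarith [h0.2]⟩ ⟨by linarith, by linarith [h0'.2]⟩ he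
    linarith

theorem exists_continuousOn_lift {h : ℝ → 𝕊} {a b : ℝ} (hab : a ≤ b)
    (hh : ContinuousOn h (Icc a b)) :
    ∃ H : ℝ → ℝ, ContinuousOn H (Icc a b) ∧ ∀ t ∈ Icc a b, (H t : 𝕊) = h t := by
  have hc : Continuous (IccExtend hab (domRestrict (Icc a b) h)) :=
    continuous_IccExtend_iff.2 hh.domRestrict
  obtain ⟨e₀, he₀⟩ := QuotientAddGroup.mk_surjective (IccExtend hab (domRestrict (Icc a b) h) 0)
  obtain ⟨H, ⟨-, hH⟩, -⟩ := (AddCircle.isCoveringMap_coe (1 : ℝ)).existsUnique_continuousMap_lifts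
    (⟨_, hc⟩ : C(ℝ, 𝕊)) 0 e₀ he₀
  refine ⟨H, H.continuous.continuousOn, fun t ht => ?_⟩
  have := congrFun hH t
  simp only [comp_apply, ContinuousMap.coe_mk] at this
  rw [this, IccExtend_of_mem _ _ ht, domRestrict_apply]

/-- `Γ` is the lift to the universal cover of a parametrization by `ℝ/ℤ` of a simple loop with
image `G` and degree `d`. -/
structure IsSimpleLoopLift (Γ : ℝ → ℝ × ℝ) (d : ℤ) (G : Set 𝔸) : Prop where
  continuous : Continuous Γ
  add_one : ∀ t, Γ (t + 1) = Γ t + ((d : ℝ), 0)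
  inj : ∀ t t', τ (Γ t) = τ (Γ t') → ∃ m : ℤ, t' = t + m
  range_eq : range (τ ∘ Γ) = G

theorem IsSimpleLoopLift.add_int {Γ : ℝ → ℝ × ℝ} {d : ℤ} {G : Set 𝔸}
    (h : IsSimpleLoopLift Γ d G) (t : ℝ) (m : ℤ) : Γ (t + m) = Γ t + ((m * d : ℝ), 0) :=
  add_int_of_add_one h.add_one m t

theorem IsSimpleLoopLift.τ_add_int {Γ : ℝ → ℝ × ℝ} {d : ℤ} {G : Set 𝔸}
    (h : IsSimpleLoopLift Γ d G) (t : ℝ) (m : ℤ) : τ (Γ (t + m)) = τ (Γ t) := by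
  rw [h.add_int]
  exact_mod_cast _root_.τ_add_int (Γ t) (m * d)

theorem IsSimpleLoopLift.mem {Γ : ℝ → ℝ × ℝ} {d : ℤ} {G : Set 𝔸}
    (h : IsSimpleLoopLift Γ d G) (t : ℝ) : τ (Γ t) ∈ G :=
  h.range_eq ▸ mem_range_self t

theorem IsSimpleLoopLift.abs_le_one {Γ : ℝ → ℝ × ℝ} {d : ℤ} {G : Set 𝔸}
    (h : IsSimpleLoopLift Γ d G) : |d| ≤ 1 :=
  abs_le_one_of_simple_periodic h.continuous h.add_one h.inj

theorem exists_isSimpleLoopLift {g : ℝ → 𝔸} {a b : ℝ} (hab : a < b)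
    (hg : ContinuousOn g (Icc a b)) (hloop : g a = g b) (hinj : InjOn g (Ico a b)) :
    ∃ Γ d, IsSimpleLoopLift Γ d (g '' Icc a b) := by
  have hmaps : MapsTo (fun t : ℝ => a + t * (b - a)) (Icc 0 1) (Icc a b) := fun t ht =>
    ⟨by nlinarith [ht.1], by nlinarith [ht.2]⟩
  have hg' : ContinuousOn (fun t : ℝ => g (a + t * (b - a))) (Icc 0 1) :=
    hg.comp (by fun_prop) hmaps
  obtain ⟨H, hHc, hH⟩ := exists_continuousOn_lift zero_le_one hg'.fst
  set P : ℝ → ℝ × ℝ := fun t => (H t, (g (a + t * (b - a))).2) with hPdef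
  have hPc : ContinuousOn P (Icc 0 1) := hHc.prodMk hg'.snd
  have hP : ∀ t ∈ Icc (0 : ℝ) 1, τ (P t) = g (a + t * (b - a)) := fun t ht =>
    Prod.ext (hH t ht) rfl
  obtain ⟨d, hd⟩ : ∃ d : ℤ, P 1 = P 0 + ((d : ℝ), 0) := τ_eq_iff.1 <| by
    rw [hP _ (by simp), hP _ (by simp)]; simpa using hloop
  have hPinj : InjOn (τ ∘ P) (Ico 0 1) := by
    intro t ht t' ht' he
    rw [comp_apply, comp_apply, hP _ (Ico_subset_Icc_self ht), hP _ (Ico_subset_Icc_self ht')] at he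
    have := hinj ⟨by nlinarith [ht.1], by nlinarith [ht.2]⟩
      ⟨by nlinarith [ht'.1], by nlinarith [ht'.2]⟩ he
    exact mul_right_cancel₀ (sub_pos.2 hab).ne' (add_left_cancel this)
  refine ⟨periodicExt P d, d, continuous_periodicExt hPc hd, periodicExt_add_one P d,
    exists_int_of_τ_periodicExt_eq hPinj, ?_⟩
  have hfr : ∀ t : ℝ, Int.fract t ∈ Icc (0 : ℝ) 1 := fun t =>
    ⟨Int.fract_nonneg t, (Int.fract_lt_one t).le⟩
  apply Subset.antisymm
  · rintro _ ⟨t, rfl⟩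
    rw [comp_apply, τ_periodicExt, hP _ (hfr t)]
    exact mem_image_of_mem _ (hmaps (hfr t))
  · rintro _ ⟨s, hs, rfl⟩
    rcases hs.2.eq_or_lt with rfl | hlt
    · exact ⟨0, by rw [comp_apply, τ_periodicExt, hP _ (hfr 0)]; simpa using hloop⟩
    · refine ⟨(s - a) / (b - a), ?_⟩
      have hf : Int.fract ((s - a) / (b - a)) = (s - a) / (b - a) := Int.fract_eq_self.2
        ⟨div_nonneg (by linarith [hs.1]) (by linarith), by
          rw [div_lt_one (by linarith)]; linarith⟩
      rw [comp_apply, τ_periodicExt, hP _ (hfr _), hf, div_mul_cancel₀ _ (sub_pos.2 hab).ne']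
      congr 1; ring

theorem eq_endpoints_of_forall_int {f : ℝ → ℝ} {a b : ℝ} (hab : a ≤ b)
    (hf : ContinuousOn f (Icc a b)) (hint : ∀ t ∈ Icc a b, ∃ n : ℤ, f t = n) : f a = f b := by
  by_contra hne
  obtain ⟨m, hm⟩ := hint a ⟨le_rfl, hab⟩
  obtain ⟨n, hn⟩ := hint b ⟨hab, le_rfl⟩
  have hmn : m ≠ n := fun h => hne (by rw [hm, hn, h])
  have hv : ((min m n : ℤ) : ℝ) + 1 / 2 ∈ uIcc (f a) (f b) := by
    rw [hm, hn, mem_uIcc]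
    rcases hmn.lt_or_gt with h | h
    · left
      have : (m : ℝ) + 1 ≤ n := by exact_mod_cast h
      rw [min_eq_left h.le]; constructor <;> linarith
    · right
      have : (n : ℝ) + 1 ≤ m := by exact_mod_cast h
      rw [min_eq_right h.le]; constructor <;> linarith
  obtain ⟨t, ht, hft⟩ := intermediate_value_uIcc (by rwa [uIcc_of_le hab]) hv
  rw [uIcc_of_le hab] at ht
  obtain ⟨k, hk⟩ := hint t ht
  have : (2 * k : ℝ) = 2 * (min m n : ℤ) + 1 := by linarith
  have : 2 * k = 2 * min m n + 1 := by exact_mod_cast this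
  omega

/-- A simple arc inside a simple loop makes less than one turn along the loop. -/
theorem IsSimpleLoopLift.exists_params {Γ : ℝ → ℝ × ℝ} {d : ℤ} {G : Set 𝔸}
    (h : IsSimpleLoopLift Γ d G) {η : ℝ → 𝔸} {ηt : ℝ → ℝ × ℝ} {a b : ℝ} (hab : a ≤ b)
    (hη : ContinuousOn η (Icc a b)) (hinj : InjOn η (Icc a b)) (hsub : η '' Icc a b ⊆ G)
    (hlift : IsLiftOn ηt η a b) :
    ∃ s t : ℝ, τ (Γ s) = η a ∧ τ (Γ t) = η b ∧ |t - s| < 1 ∧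
      W ηt a b = (Γ t).1 - (Γ s).1 := by
  have hτ : Continuous τ := by unfold τ; fun_prop
  have hper : Function.Periodic (τ ∘ Γ) 1 := fun t => by
    simpa using h.τ_add_int t 1
  set e : 𝕊 → 𝔸 := hper.lift with he_def
  have he : ∀ t : ℝ, e (t : 𝕊) = τ (Γ t) := fun t => hper.lift_coe t
  have hec : Continuous e := continuous_quot_lift _ (hτ.comp h.continuous)
  have heinj : Injective e := by
    intro u v huv
    induction u using QuotientAddGroup.induction_on with | H u => ?_
    induction v using QuotientAddGroup.induction_on with | H v => ?_
    obtain ⟨m, rfl⟩ := h.inj _ _ ((he u).symm.trans (huv.trans (he v)))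
    have hm : ((m : ℝ) : 𝕊) = 0 := (AddCircle.coe_eq_zero_iff 1).2 ⟨m, by simp⟩
    change (u : 𝕊) = ((u + m : ℝ) : 𝕊)
    rw [AddCircle.coe_add, hm, add_zero]
  have hemb := hec.isClosedEmbedding heinj
  have hrange : ∀ t ∈ Icc a b, ∃ u, e u = η t := by
    intro t ht
    obtain ⟨s, hs⟩ : η t ∈ range (τ ∘ Γ) := h.range_eq ▸ hsub (mem_image_of_mem _ ht)
    exact ⟨s, (he s).trans hs⟩
  choose! φ hφ using hrange
  have hφc : ContinuousOn φ (Icc a b) :=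
    hemb.isInducing.continuousOn_iff.2 (hη.congr fun t ht => hφ t ht)
  obtain ⟨S, hSc, hS⟩ := exists_continuousOn_lift hab hφc
  have hΓS : ∀ t ∈ Icc a b, τ (Γ (S t)) = η t := fun t ht => by rw [← he, hS t ht, hφ t ht]
  refine ⟨S a, S b, hΓS a ⟨le_rfl, hab⟩, hΓS b ⟨hab, le_rfl⟩, ?_, ?_⟩
  · by_contra! hge
    obtain ⟨ε, hε⟩ : ∃ ε : ℤ, ε ≠ 0 ∧ S a + ε ∈ uIcc (S a) (S b) := by
      rcases le_abs.1 hge with h1 | h1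
      · exact ⟨1, one_ne_zero, by rw [mem_uIcc]; left; constructor <;> push_cast <;> linarith⟩
      · exact ⟨-1, by decide, by rw [mem_uIcc]; right; constructor <;> push_cast <;> linarith⟩
    obtain ⟨r, hr, hSr⟩ := intermediate_value_uIcc (by rwa [uIcc_of_le hab]) hε.2
    rw [uIcc_of_le hab] at hr
    have hη' : η r = η a := by
      rw [← hΓS r hr, ← hΓS a ⟨le_rfl, hab⟩, hSr, h.τ_add_int]
    rw [hinj hr ⟨le_rfl, hab⟩ hη', left_eq_add] at hSr
    exact hε.1 (by exact_mod_cast hSr)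
  · have := eq_endpoints_of_forall_int (f := fun t => (ηt t).1 - (Γ (S t)).1) hab
      (hlift.1.fst.sub (h.continuous.comp_continuousOn hSc).fst) (fun t ht => by
        obtain ⟨n, hn⟩ := τ_eq_iff.1 ((hΓS t ht).trans (hlift.2 t ht).symm)
        exact ⟨n, by simp [hn]⟩)
    unfold W
    linarith

theorem eq_zero_of_abs_lt_one {x : ℝ} (hx : |x| < 1) {n : ℤ} (hn : x = n) : x = 0 := by
  rw [hn] at hx ⊢
  exact_mod_cast Int.abs_lt_one_iff.1 (by exact_mod_cast hx)

/-- An arc meeting a simple loop only at its endpoints is closed up by an arc of the loop to a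
simple loop, so it winds at most once more than that arc. -/
theorem IsSimpleLoopLift.abs_le_one_of_chord {Γ : ℝ → ℝ × ℝ} {d : ℤ} {G : Set 𝔸}
    (h : IsSimpleLoopLift Γ d G) {C : ℝ → ℝ × ℝ} (hC : ContinuousOn C (Icc 0 1))
    (hinj : InjOn (τ ∘ C) (Icc 0 1)) (hCG : ∀ t ∈ Icc (0 : ℝ) 1, τ (C t) ∈ G → t = 0 ∨ t = 1)
    {s₀ s₁ : ℝ} {i j m : ℤ} (h0 : C 0 = Γ s₀ + ((i : ℝ), 0)) (h1 : C 1 = Γ s₁ + ((j : ℝ), 0))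
    (hne : s₁ - s₀ ≠ m) (hlt : |s₁ - m - s₀| < 1) : |j - i + d * m| ≤ 1 := by
  obtain ⟨s, rfl⟩ : ∃ s, s₁ = s + m := ⟨s₁ - m, by ring⟩
  rw [add_sub_cancel_right, abs_sub_comm] at hlt
  have hne' : s₀ - s ≠ 0 := fun h => hne (by linarith)
  have hzero : ∀ u : ℝ, |u| ≤ 1 → ∀ n : ℤ, u * (s₀ - s) = n → u = 0 := fun u hu n hn =>
    (mul_eq_zero.1 (eq_zero_of_abs_lt_one (by
      rw [abs_mul]; exact (mul_le_of_le_one_left (abs_nonneg _) hu).trans_lt hlt) hn)).resolve_right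
      hne'
  set Q : ℝ → ℝ × ℝ := fun t => Γ (s + t * (s₀ - s)) + (((d * m + j : ℤ) : ℝ), 0) with hQ
  have hτQ : ∀ t, τ (Q t) = τ (Γ (s + t * (s₀ - s))) := fun t => _root_.τ_add_int _ _
  have hQc : Continuous Q := by
    have := h.continuous
    fun_prop
  have hCQ : C 1 = Q 0 := by
    rw [h1, h.add_int]
    ext
    · simp [hQ]; ring
    · simp [hQ]
  refine abs_le_one_of_injOn_Ico (P := concat C Q) (continuousOn_concat hC hQc.continuousOn hCQ)
    ?_ (injOn_concat Ico_subset_Icc_self hinj ?_ ?_)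
  · rw [concat_zero, concat_one, h0]
    ext
    · simp [hQ]; ring
    · simp [hQ]
  · intro t ht t' ht' he
    rw [comp_apply, comp_apply, hτQ, hτQ] at he
    obtain ⟨n, hn⟩ := h.inj _ _ he
    have := hzero (t' - t) (by rw [abs_le]; constructor <;> linarith [ht.1, ht.2, ht'.1, ht'.2]) n
      (by linarith)
    linarith
  · intro t ht t' ht' he
    rw [hτQ] at he
    rcases hCG t ht (he ▸ h.mem _) with rfl | rfl
    · right
      rw [h0, _root_.τ_add_int] at he
      obtain ⟨n, hn⟩ := h.inj _ _ he
      have := hzero (t' - 1) (by rw [abs_le]; constructor <;> linarith [ht'.1, ht'.2]) n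
        (by linarith)
      exact ⟨rfl, by linarith, by simp⟩
    · left
      rw [h1, _root_.τ_add_int, h.τ_add_int] at he
      obtain ⟨n, hn⟩ := h.inj _ _ he
      exact hzero t' (by rw [abs_le]; constructor <;> linarith [ht'.1, ht'.2]) n (by linarith)

/-- Two arcs in the annulus with the same origin have a last meeting point along the second one. -/
theorem exists_last_meeting {X U : ℝ → ℝ × ℝ} {ax bx au bu : ℝ} (hx : ax ≤ bx) (hu : au ≤ bu)
    (hX : ContinuousOn X (Icc ax bx)) (hU : ContinuousOn U (Icc au bu))
    (h0 : τ (X ax) = τ (U au)) :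
    ∃ p ∈ Icc ax bx, ∃ q ∈ Icc au bu, τ (X p) = τ (U q) ∧
      ∀ p' ∈ Icc ax bx, ∀ q' ∈ Icc au bu, τ (X p') = τ (U q') → q' ≤ q := by
  have hτ : Continuous τ := by unfold τ; fun_prop
  have hK : IsClosed ((τ ∘ X) '' Icc ax bx) :=
    (isCompact_Icc.image_of_continuousOn (hτ.comp_continuousOn hX)).isClosed
  have hcl : IsClosed (Icc au bu ∩ (τ ∘ U) ⁻¹' ((τ ∘ X) '' Icc ax bx)) :=
    (hτ.comp_continuousOn hU).preimage_isClosed_of_isClosed isClosed_Icc hK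
  obtain ⟨q, ⟨hq, p, hp, hpq⟩, hmax⟩ :=
    (isCompact_Icc.of_isClosed_subset hcl inter_subset_left).exists_isGreatest
      ⟨au, ⟨le_rfl, hu⟩, ax, ⟨le_rfl, hx⟩, h0⟩
  exact ⟨p, hp, q, hq, hpq, fun p' hp' q' hq' he => hmax ⟨hq', p', hp', he⟩⟩

theorem abs_sub_le_D {X : ℝ → ℝ × ℝ} {a b : ℝ} (hX : ContinuousOn X (Icc a b)) {r r' : ℝ}
    (hr : r ∈ Icc a b) (hr' : r' ∈ Icc a b) : |(X r).1 - (X r').1| ≤ D X a b := by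
  rw [← Real.dist_eq]
  exact dist_le_diam_of_mem
    ((isCompact_Icc.image_of_continuousOn hX).image continuous_fst).isBounded
    (mem_image_of_mem _ (mem_image_of_mem _ hr)) (mem_image_of_mem _ (mem_image_of_mem _ hr'))

theorem D_nonneg (X : ℝ → ℝ × ℝ) (a b : ℝ) : 0 ≤ D X a b := diam_nonneg

/-- Two arcs with a common origin, each meeting the simple loop only at its final endpoint, differ
by a bounded amount of winding, up to the turns made along the loop between their endpoints. -/
theorem IsSimpleLoopLift.exists_int_of_arcs {Γ : ℝ → ℝ × ℝ} {d : ℤ} {G : Set 𝔸}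
    (h : IsSimpleLoopLift Γ d G) {X U : ℝ → ℝ × ℝ} {ax bx au bu : ℝ}
    (hx : ax ≤ bx) (hu : au ≤ bu)
    (hX : ContinuousOn X (Icc ax bx)) (hU : ContinuousOn U (Icc au bu))
    (hXinj : InjOn (τ ∘ X) (Icc ax bx)) (hUinj : InjOn (τ ∘ U) (Icc au bu))
    (hXG : ∀ r ∈ Icc ax bx, τ (X r) ∈ G → r = bx) (hUG : ∀ r ∈ Icc au bu, τ (U r) ∈ G → r = bu)
    (h0 : τ (X ax) = τ (U au)) {s₀ s₁ : ℝ}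
    (hs₀ : τ (Γ s₀) = τ (X bx)) (hs₁ : τ (Γ s₁) = τ (U bu)) :
    ∃ k : ℤ, |(Γ s₁).1 + k - (Γ s₀).1| ≤ D U au bu + D X ax bx ∧
      |(k : ℝ) + d * (s₁ - s₀)| ≤ 1 := by
  obtain ⟨p, hp, q, hq, hpq, hmax⟩ := exists_last_meeting hx hu hX hU h0
  by_cases hpb : p = bx
  · have hqb : q = bu := hUG q hq (by rw [← hpq, hpb, ← hs₀]; exact h.mem _)
    obtain ⟨m, rfl⟩ := h.inj s₀ s₁ (by rw [hs₀, hs₁, ← hpb, ← hqb, hpq])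
    refine ⟨-(m * d), ?_, ?_⟩
    · rw [h.add_int]
      push_cast
      simpa using add_nonneg (D_nonneg U au bu) (D_nonneg X ax bx)
    · push_cast
      rw [show -((m : ℝ) * d) + d * (s₀ + m - s₀) = 0 by ring]
      simp
  have hqb : q ≠ bu := fun hqb => hpb (hXG p hp (by rw [hpq, hqb, ← hs₁]; exact h.mem _))
  replace hpb : p < bx := lt_of_le_of_ne hp.2 hpb
  replace hqb : q < bu := lt_of_le_of_ne hq.2 hqb
  obtain ⟨n, hn⟩ := τ_eq_iff.1 hpq
  obtain ⟨i, hi⟩ := τ_eq_iff.1 hs₀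
  obtain ⟨j, hj⟩ := τ_eq_iff.1 hs₁
  have hni : ∀ m : ℤ, s₁ - s₀ ≠ m := by
    intro m hm
    obtain rfl : s₁ = s₀ + m := by linarith
    rw [h.τ_add_int] at hs₁
    exact hqb.not_ge (hmax bx ⟨hx, le_rfl⟩ bu ⟨hu, le_rfl⟩ (hs₀.symm.trans hs₁))
  set P : ℝ → ℝ × ℝ := fun t => X (bx + t * (p - bx)) with hP
  set Q : ℝ → ℝ × ℝ := fun t => U (q + t * (bu - q)) + (((-n : ℤ) : ℝ), 0) with hQ
  have hτQ : ∀ t, τ (Q t) = τ (U (q + t * (bu - q))) := fun t => _root_.τ_add_int _ _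
  have hPm : ∀ t ∈ Icc (0 : ℝ) 1, bx + t * (p - bx) ∈ Icc ax bx := fun t ht =>
    ⟨by nlinarith [ht.1, ht.2, hp.1], by nlinarith [ht.1]⟩
  have hQm : ∀ t ∈ Icc (0 : ℝ) 1, q + t * (bu - q) ∈ Icc au bu := fun t ht =>
    ⟨by nlinarith [ht.1, hq.1], by nlinarith [ht.2]⟩
  have hPc : ContinuousOn P (Icc 0 1) := hX.comp (by fun_prop) hPm
  have hQc : ContinuousOn Q (Icc 0 1) := (hU.comp (by fun_prop) hQm).add (by fun_prop)
  have hPQ : P 1 = Q 0 := by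
    have : U q = X p + ((n : ℝ), 0) := hn
    ext <;> simp [hP, hQ, this]
  have hinj : InjOn (τ ∘ concat P Q) (Icc 0 1) := by
    refine injOn_concat Subset.rfl ?_ ?_ ?_
    · intro t ht t' ht' he
      have := hXinj (hPm t ht) (hPm t' ht') he
      exact mul_right_cancel₀ (sub_neg.2 hpb).ne (add_left_cancel this)
    · intro t ht t' ht' he
      rw [comp_apply, comp_apply, hτQ, hτQ] at he
      have := hUinj (hQm t ht) (hQm t' ht') he
      exact mul_right_cancel₀ (sub_pos.2 hqb).ne' (add_left_cancel this)
    · intro t ht t' ht' he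
      rw [hτQ] at he
      have := hmax _ (hPm t ht) _ (hQm t' ht') he
      left
      nlinarith [ht'.1]
  have hCG : ∀ t ∈ Icc (0 : ℝ) 1, τ (concat P Q t) ∈ G → t = 0 ∨ t = 1 := by
    intro t ht hmem
    unfold concat at hmem
    split_ifs at hmem with h2
    · left
      have := hXG _ (hPm (2 * t) ⟨by linarith [ht.1], by linarith⟩) hmem
      nlinarith [ht.1]
    · right
      rw [hτQ] at hmem
      have := hUG _ (hQm (2 * t - 1) ⟨by linarith, by linarith [ht.2]⟩) hmem
      nlinarith [ht.2]
  have hC0 : concat P Q 0 = Γ s₀ + ((i : ℝ), 0) := by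
    rw [concat_zero, ← hi]; simp [hP]
  have hC1 : concat P Q 1 = Γ s₁ + (((j - n : ℤ) : ℝ), 0) := by
    have h1 : Q 1 = U bu + (((-n : ℤ) : ℝ), 0) := by simp [hQ]
    rw [concat_one, h1, hj]
    ext
    · simp; ring
    · simp
  have hchord : ∀ m : ℤ, |s₁ - m - s₀| < 1 → |j - n - i + d * m| ≤ 1 := fun m hm =>
    h.abs_le_one_of_chord (continuousOn_concat hPc hQc hPQ) hinj hCG hC0 hC1 (hni m) hm
  refine ⟨j - n - i, ?_, ?_⟩
  · have hX' := abs_sub_le_D hX hp ⟨hx, le_rfl⟩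
    have hU' := abs_sub_le_D hU ⟨hu, le_rfl⟩ hq
    have e1 := congrArg Prod.fst hn
    have e2 := congrArg Prod.fst hi
    have e3 := congrArg Prod.fst hj
    simp only [Prod.fst_add] at e1 e2 e3
    push_cast
    rw [show (Γ s₁).1 + ((j : ℝ) - n - i) - (Γ s₀).1
      = ((U bu).1 - (U q).1) + ((X p).1 - (X bx).1) by linarith]
    exact (abs_add_le _ _).trans (add_le_add hU' hX')
  · have hf0 := Int.fract_nonneg (s₁ - s₀)
    have hf1 := Int.fract_lt_one (s₁ - s₀)
    have hf2 := Int.floor_add_fract (s₁ - s₀)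
    have hfpos : 0 < Int.fract (s₁ - s₀) :=
      hf0.lt_of_ne fun h0 => hni _ (by rw [← h0] at hf2; linarith)
    have hA := hchord ⌊s₁ - s₀⌋ (by rw [abs_lt]; constructor <;> linarith)
    have hB := hchord (⌊s₁ - s₀⌋ + 1) (by push_cast; rw [abs_lt]; constructor <;> linarith)
    have hA' : |((j - n - i : ℤ) : ℝ) + d * ⌊s₁ - s₀⌋| ≤ 1 := by exact_mod_cast hA
    have hB' : |((j - n - i : ℤ) : ℝ) + d * (⌊s₁ - s₀⌋ + 1)| ≤ 1 := by exact_mod_cast hB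
    rw [abs_le] at hA' hB' ⊢
    rw [← hf2]
    constructor <;> nlinarith [hA'.1, hA'.2, hB'.1, hB'.2]

theorem eq_right_of_lift_mem {σ : ℝ → 𝔸} {X : ℝ → ℝ × ℝ} {a b : ℝ} {G : Set 𝔸} (hab : a ≤ b)
    (hσ : InjOn σ (Icc a b)) (hX : IsLiftOn X σ a b) (hdisj : σ '' Icc a b ∩ G ⊆ {σ b}) :
    ∀ r ∈ Icc a b, τ (X r) ∈ G → r = b := fun r hr hmem =>
  hσ hr ⟨hab, le_rfl⟩ (hdisj ⟨mem_image_of_mem _ hr, hX.2 r hr ▸ hmem⟩)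

theorem image_comp_inter_subset {fh : 𝔸 → 𝔸} (hfh : IsHomeomorph fh) {σ : ℝ → 𝔸} {S : Set ℝ}
    {G : Set 𝔸} {b : ℝ} (hdisj : σ '' S ∩ G ⊆ {σ b}) :
    (fh ∘ σ) '' S ∩ fh '' G ⊆ {(fh ∘ σ) b} := by
  rw [image_comp, ← image_inter hfh.injective]
  exact (image_mono hdisj).trans (by simp)

theorem eq_of_image_subset_singleton {η : ℝ → 𝔸} {a b : ℝ} {z : 𝔸} (hab : a ≤ b)
    (hη : InjOn η (Icc a b)) (hsub : η '' Icc a b ⊆ {z}) : a = b :=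
  hη ⟨le_rfl, hab⟩ ⟨hab, le_rfl⟩ <|
    (hsub (mem_image_of_mem _ ⟨le_rfl, hab⟩)).trans (hsub (mem_image_of_mem _ ⟨hab, le_rfl⟩)).symm

theorem dragging_lemma
    (fh : 𝔸 → 𝔸) (hfh : IsHomeomorph fh)
    (hhtpy : ContinuousMap.Homotopic ⟨fh, hfh.continuous⟩ (ContinuousMap.id 𝔸))
    -- a simple loop `γ : [a,b] → 𝔸`:
    (a b : ℝ) (hab : a ≤ b)
    (γ : ℝ → 𝔸) (hγc : ContinuousOn γ (Set.Icc a b))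
    (hγloop : γ a = γ b) (hγsimple : Set.InjOn γ (Set.Ico a b))
    (x y : 𝔸)
    -- `σ_x : [ax,bx] → 𝔸` joins `x` to `γ`, touching `γ` only at `x₀ = σ_x(bx)`:
    (ax bx : ℝ) (haxbx : ax ≤ bx)
    (σx : ℝ → 𝔸) (hσxc : ContinuousOn σx (Set.Icc ax bx))
    (hσxinj : Set.InjOn σx (Set.Icc ax bx))
    (hσxi : σx ax = x) (hσxf : σx bx ∈ γ '' Set.Icc a b)
    (hσxdisj : σx '' Set.Icc ax bx ∩ γ '' Set.Icc a b ⊆ {σx bx})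
    -- `σ_y : [ay,by] → 𝔸` joins `y` to `γ`, touching `γ` only at `y₀ = σ_y(by)`:
    (ay by' : ℝ) (hayby : ay ≤ by')
    (σy : ℝ → 𝔸) (hσyc : ContinuousOn σy (Set.Icc ay by'))
    (hσyinj : Set.InjOn σy (Set.Icc ay by'))
    (hσyi : σy ay = y) (hσyf : σy by' ∈ γ '' Set.Icc a b)
    (hσydisj : σy '' Set.Icc ay by' ∩ γ '' Set.Icc a b ⊆ {σy by'})
    -- `σ_{f(x)} : [au,bu] → 𝔸` joins `f̂(x)` to `f̂(γ)`, touching it only at `x₁`: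
    (au bu : ℝ) (haubu : au ≤ bu)
    (σfx : ℝ → 𝔸) (hσfxc : ContinuousOn σfx (Set.Icc au bu))
    (hσfxinj : Set.InjOn σfx (Set.Icc au bu))
    (hσfxi : σfx au = fh x) (hσfxf : σfx bu ∈ fh '' (γ '' Set.Icc a b))
    (hσfxdisj : σfx '' Set.Icc au bu ∩ fh '' (γ '' Set.Icc a b) ⊆ {σfx bu})
    -- `σ_{f(y)} : [av,bv] → 𝔸` joins `f̂(y)` to `f̂(γ)`, touching it only at `y₁`:
    (av bv : ℝ) (havbv : av ≤ bv)
    (σfy : ℝ → 𝔸) (hσfyc : ContinuousOn σfy (Set.Icc av bv))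
    (hσfyinj : Set.InjOn σfy (Set.Icc av bv))
    (hσfyi : σfy av = fh y) (hσfyf : σfy bv ∈ fh '' (γ '' Set.Icc a b))
    (hσfydisj : σfy '' Set.Icc av bv ∩ fh '' (γ '' Set.Icc a b) ⊆ {σfy bv})
    -- `I : [aI,bI] → 𝔸` is a simple arc in `γ` joining `x₀` to `y₀`:
    (aI bI : ℝ) (haIbI : aI ≤ bI)
    (ι : ℝ → 𝔸) (hιc : ContinuousOn ι (Set.Icc aI bI))
    (hιinj : Set.InjOn ι (Set.Icc aI bI))
    (hιsub : ι '' Set.Icc aI bI ⊆ γ '' Set.Icc a b)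
    (hιi : ι aI = σx bx) (hιf : ι bI = σy by')
    -- `I′ : [aJ,bJ] → 𝔸` is a simple arc in `f̂(γ)` joining `x₁` to `y₁`:
    (aJ bJ : ℝ) (haJbJ : aJ ≤ bJ)
    (ι' : ℝ → 𝔸) (hι'c : ContinuousOn ι' (Set.Icc aJ bJ))
    (hι'inj : Set.InjOn ι' (Set.Icc aJ bJ))
    (hι'sub : ι' '' Set.Icc aJ bJ ⊆ fh '' (γ '' Set.Icc a b))
    (hι'i : ι' aJ = σfx bu) (hι'f : ι' bJ = σfy bv)
    -- lifts of `I′`, `f̂∘I`, `σ_{f(x)}`, `f̂∘σ_x`, `σ_{f(y)}`, `f̂∘σ_y`: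
    (ι't : ℝ → ℝ × ℝ) (hι't : IsLiftOn ι't ι' aJ bJ)
    (ηt : ℝ → ℝ × ℝ) (hηt : IsLiftOn ηt (fh ∘ ι) aI bI)
    (ut : ℝ → ℝ × ℝ) (hut : IsLiftOn ut σfx au bu)
    (xt : ℝ → ℝ × ℝ) (hxt : IsLiftOn xt (fh ∘ σx) ax bx)
    (vt : ℝ → ℝ × ℝ) (hvt : IsLiftOn vt σfy av bv)
    (yt : ℝ → ℝ × ℝ) (hyt : IsLiftOn yt (fh ∘ σy) ay by') :
    |W ι't aJ bJ - W ηt aI bI| ≤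
      3 + D ut au bu + D xt ax bx + D vt av bv + D yt ay by' := by
  rcases hab.eq_or_lt with rfl | hlt
  · have hI : aI = bI := eq_of_image_subset_singleton haIbI hιinj (by simpa using hιsub)
    have hJ : aJ = bJ := eq_of_image_subset_singleton haJbJ hι'inj (by simpa using hι'sub)
    subst hI hJ
    have h1 := D_nonneg ut au bu
    have h2 := D_nonneg xt ax bx
    have h3 := D_nonneg vt av bv
    have h4 := D_nonneg yt ay by'
    simp only [W, sub_self, abs_zero]
    linarith
  obtain ⟨Γ, d, hΓ⟩ := exists_isSimpleLoopLift (g := fh ∘ γ) hlt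
    (hfh.continuous.comp_continuousOn hγc) (congrArg fh hγloop)
    (hfh.injective.comp_injOn hγsimple)
  rw [image_comp] at hΓ
  obtain ⟨s₀, t₀, hs₀, ht₀, hst₀, hW₀⟩ := hΓ.exists_params haIbI
    (hfh.continuous.comp_continuousOn hιc) (hfh.injective.comp_injOn hιinj)
    (by rw [image_comp]; exact image_mono hιsub) hηt
  obtain ⟨s₁, t₁, hs₁, ht₁, hst₁, hW₁⟩ := hΓ.exists_params haJbJ hι'c hι'inj hι'sub hι't
  have hfx := hfh.injective.comp_injOn hσxinj
  have hfy := hfh.injective.comp_injOn hσyinj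
  obtain ⟨k, hk, hk'⟩ := hΓ.exists_int_of_arcs haxbx haubu hxt.1 hut.1
    (hfx.congr fun r hr => (hxt.2 r hr).symm) (hσfxinj.congr fun r hr => (hut.2 r hr).symm)
    (eq_right_of_lift_mem haxbx hfx hxt (image_comp_inter_subset hfh hσxdisj))
    (eq_right_of_lift_mem haubu hσfxinj hut hσfxdisj)
    (by rw [hxt.2 _ ⟨le_rfl, haxbx⟩, hut.2 _ ⟨le_rfl, haubu⟩, hσfxi, comp_apply, hσxi])
    (s₀ := s₀) (s₁ := s₁)
    (by rw [hxt.2 _ ⟨haxbx, le_rfl⟩, hs₀, comp_apply, hιi, comp_apply])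
    (by rw [hut.2 _ ⟨haubu, le_rfl⟩, hs₁, hι'i])
  obtain ⟨l, hl, hl'⟩ := hΓ.exists_int_of_arcs hayby havbv hyt.1 hvt.1
    (hfy.congr fun r hr => (hyt.2 r hr).symm) (hσfyinj.congr fun r hr => (hvt.2 r hr).symm)
    (eq_right_of_lift_mem hayby hfy hyt (image_comp_inter_subset hfh hσydisj))
    (eq_right_of_lift_mem havbv hσfyinj hvt hσfydisj)
    (by rw [hyt.2 _ ⟨le_rfl, hayby⟩, hvt.2 _ ⟨le_rfl, havbv⟩, hσfyi, comp_apply, hσyi])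
    (s₀ := t₀) (s₁ := t₁)
    (by rw [hyt.2 _ ⟨hayby, le_rfl⟩, ht₀, comp_apply, hιf, comp_apply])
    (by rw [hvt.2 _ ⟨havbv, le_rfl⟩, ht₁, hι'f])
  have hkl : |k - l| ≤ 3 := by
    have hd : |(d : ℝ)| ≤ 1 := by exact_mod_cast hΓ.abs_le_one
    have hturn : |d * ((t₁ - s₁) - (t₀ - s₀))| < 2 := by
      rw [abs_mul]
      refine (mul_le_of_le_one_left (abs_nonneg _) hd).trans_lt ?_
      exact (abs_sub _ _).trans_lt (by linarith)
    have hlt4 : |(k : ℝ) - l| < 4 := by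
      rw [abs_lt] at hturn ⊢
      rw [abs_le] at hk' hl'
      constructor <;> linarith [hk'.1, hk'.2, hl'.1, hl'.2, hturn.1, hturn.2]
    have : |k - l| < 4 := by exact_mod_cast hlt4
    omega
  have hkl' : |(k : ℝ) - l| ≤ 3 := by exact_mod_cast hkl
  rw [hW₀, hW₁, abs_le]
  rw [abs_le] at hk hl hkl'
  constructor <;> linarith [hk.1, hk.2, hl.1, hl.2, hkl'.1, hkl'.2]
end
end
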